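/- arXiv:2602.11382 — 11 statements merged into one kernel-verified Lean document; each statement's English description precedes it below -/
import Mathlib

section
/- Let H = (V, E) be a finite hypergraph (V a finite set, E a finite family of nonempty subsets of V) with maximal degree Δ ≥ 1, i.e. every vertex belongs to at most Δ edges. Then there exists a vertex cover T ⊆ V (a set meeting every edge of E) whose size satisfies |T| ≤ (1 + 1/2 + ⋯ + 1/Δ) · τ*(H), where τ*(H) is the fractional cover number of H. (In the paper this cover is produced by the greedy algorithm.) -/
noncomputable section

/-- A block of harmonic terms with indices at most `d` is at least its length divided by `d`. -/
theorem sum_one_div_add_sub_div_le {a b d : ℕ} (hab : a ≤ b) (hbd : b ≤ d) :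
    (∑ i ∈ Finset.Icc 1 a, (1 : ℝ) / i) + ((b : ℝ) - a) * (1 / d) ≤
      ∑ i ∈ Finset.Icc 1 b, (1 : ℝ) / i := by
  induction b, hab using Nat.le_induction with
  | base => simp
  | succ n _ ih =>
    rw [Finset.sum_Icc_succ_top (by omega)]
    have h := ih (by omega)
    have hd : (1 : ℝ) / d ≤ 1 / ((n + 1 : ℕ) : ℝ) :=
      one_div_le_one_div_of_le (by positivity) (by exact_mod_cast hbd)
    push_cast at hd ⊢
    linarith

/-- The greedy cover of a finite hypergraph, together with the charge `y e` that each edge pays: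
the charges account for every vertex of the cover, and the edges at a vertex of degree `k` pay
at most the `k`-th harmonic number in total. -/
theorem exists_cover_charge {V : Type*} [Fintype V] [DecidableEq V]
    (E : Finset (Finset V)) (hE : ∀ e ∈ E, e.Nonempty) :
    ∃ (T : Finset V) (y : Finset V → ℝ),
      (∀ e ∈ E, ∃ v ∈ T, v ∈ e) ∧ (∀ e, 0 ≤ y e) ∧ (T.card : ℝ) ≤ ∑ e ∈ E, y e ∧
      ∀ v : V, ∑ e ∈ E with v ∈ e, y e ≤
        ∑ i ∈ Finset.Icc 1 (E.filter (fun e => v ∈ e)).card, (1 : ℝ) / i := by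
  induction E using Finset.strongInduction with
  | H E ih =>
    rcases E.eq_empty_or_nonempty with rfl | ⟨e₀, he₀⟩
    · exact ⟨∅, 0, by simp, by simp, by simp, by simp⟩
    obtain ⟨v₀, hv₀⟩ := hE e₀ he₀
    obtain ⟨w, -, hw⟩ := Finset.exists_max_image Finset.univ
      (fun v : V => (E.filter (fun e => v ∈ e)).card) ⟨v₀, Finset.mem_univ _⟩
    set d := (E.filter (fun e => w ∈ e)).card with hd
    have hd_pos : 0 < d :=
      (Finset.card_pos.2 ⟨e₀, Finset.mem_filter.2 ⟨he₀, hv₀⟩⟩).trans_le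
        (hw v₀ (Finset.mem_univ _))
    obtain ⟨e₁, he₁⟩ := Finset.card_pos.1 hd_pos
    rw [Finset.mem_filter] at he₁
    obtain ⟨T, y, hT, hy, hcard, hsum⟩ := ih (E.filter (fun e => w ∉ e))
      (Finset.filter_ssubset.2 ⟨e₁, he₁.1, not_not.2 he₁.2⟩)
      (fun e he => hE e (Finset.mem_of_mem_filter e he))
    have hsplit : ∀ F : Finset (Finset V),
        ∑ e ∈ F, (if w ∈ e then (1 : ℝ) / d else y e) =
          (F.filter (fun e => w ∈ e)).card * (1 / d : ℝ) + ∑ e ∈ F with w ∉ e, y e := by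
      intro F
      rw [Finset.sum_ite, Finset.sum_const, nsmul_eq_mul]
    refine ⟨insert w T, fun e => if w ∈ e then 1 / d else y e, ?_, ?_, ?_, ?_⟩
    · intro e he
      by_cases hwe : w ∈ e
      · exact ⟨w, Finset.mem_insert_self _ _, hwe⟩
      · obtain ⟨v, hv, hve⟩ := hT e (Finset.mem_filter.2 ⟨he, hwe⟩)
        exact ⟨v, Finset.mem_insert_of_mem hv, hve⟩
    · intro e
      dsimp only
      split_ifs
      · positivity
      · exact hy e
    · rw [hsplit, ← hd, mul_one_div_cancel (by positivity)]
      have h : ((insert w T).card : ℝ) ≤ T.card + 1 := by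
        exact_mod_cast Finset.card_insert_le w T
      linarith
    · intro v
      rw [hsplit]
      have hv := hsum v
      rw [Finset.filter_comm] at hv
      have hadd := Finset.card_filter_add_card_filter_not
        (s := E.filter (fun e => v ∈ e)) (fun e => w ∈ e)
      have hle := sum_one_div_add_sub_div_le
        (Finset.card_filter_le (E.filter (fun e => v ∈ e)) (fun e => w ∉ e))
        (hw v (Finset.mem_univ _))
      rw [← hadd] at hle ⊢
      push_cast at hle
      rw [add_sub_cancel_right] at hle
      linarith

/-- Lovász's analysis of the greedy algorithm for vertex cover in hypergraphs:
a hypergraph `(V, E)` with nonempty edges and maximal degree at most `Δ ≥ 1`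
admits a vertex cover `T` with `|T| ≤ (1 + 1/2 + ⋯ + 1/Δ) · τ*(H)`, where
`τ*(H)` is the fractional cover number. -/
theorem stmt0 {V : Type*} [Fintype V] [DecidableEq V]
    (E : Finset (Finset V)) (hE : ∀ e ∈ E, e.Nonempty)
    (Δ : ℕ) (hΔ : 1 ≤ Δ)
    (hdeg : ∀ v : V, (E.filter (fun e => v ∈ e)).card ≤ Δ) :
    ∃ T : Finset V,
      (∀ e ∈ E, ∃ v ∈ T, v ∈ e) ∧
      (T.card : ℝ) ≤ (∑ i ∈ Finset.Icc 1 Δ, (1 : ℝ) / i) *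
        sInf {s : ℝ | ∃ t : V → ℝ,
          (∀ v, 0 ≤ t v) ∧ (∀ e ∈ E, 1 ≤ ∑ v ∈ e, t v) ∧ s = ∑ v : V, t v} := by
  obtain ⟨T, y, hT, hy, hcard, hsum⟩ := exists_cover_charge E hE
  refine ⟨T, hT, ?_⟩
  have hpos : (0 : ℝ) < ∑ i ∈ Finset.Icc 1 Δ, (1 : ℝ) / i :=
    Finset.sum_pos (fun i hi => by
      have : 0 < i := (Finset.mem_Icc.1 hi).1
      positivity) ⟨1, Finset.mem_Icc.2 ⟨le_rfl, hΔ⟩⟩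
  rw [← div_le_iff₀' hpos]
  refine le_csInf ⟨_, fun _ => 1, fun _ => zero_le_one, fun e he => ?_, rfl⟩ ?_
  · simpa using (hE e he).card_pos
  rintro s ⟨t, ht, hcov, rfl⟩
  rw [div_le_iff₀' hpos]
  calc (T.card : ℝ) ≤ ∑ e ∈ E, y e := hcard
    _ ≤ ∑ e ∈ E, ∑ v ∈ e, y e * t v := by
      refine Finset.sum_le_sum fun e he => ?_
      rw [← Finset.mul_sum]
      exact le_mul_of_one_le_right (hy e) (hcov e he)
    _ = ∑ v : V, ∑ e ∈ E with v ∈ e, y e * t v :=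
      Finset.sum_comm' (by simp)
    _ ≤ ∑ v : V, (∑ i ∈ Finset.Icc 1 Δ, (1 : ℝ) / i) * t v := by
      refine Finset.sum_le_sum fun v _ => ?_
      rw [← Finset.sum_mul]
      refine mul_le_mul_of_nonneg_right ((hsum v).trans ?_) (ht v)
      exact Finset.sum_le_sum_of_subset_of_nonneg
        (Finset.Icc_subset_Icc_right (hdeg v)) fun i _ _ => by positivity
    _ = _ := (Finset.mul_sum ..).symm
end
end

section
/- For every n ≥ 2 and every k with 1 ≤ k ≤ ⌊n/2⌋, there exists a family T_k of k-element subsets of [n] = {1, …, n} with |T_k| ≤ (1 + k·ln(n)) · 2^{−k} · C(n, k), such that for every matching M on the complete graph K_n consisting of exactly k edges, there exists X ∈ T_k with the property that every edge of M has exactly one endpoint in X (equivalently, M ⊆ E(X, [n]∖X)). -/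
noncomputable section

open Classical in
/-- The greedy covering bound, with a potential that is linear in the number of uncovered points. -/
theorem exists_cover_card_le_of_fiber_bounds {α β : Type*} (R : α → β → Prop) (S : Finset β)
    (r : ℕ) (hr : 0 < r) (d : ℕ) :
    ∀ (m : ℕ) (U : Finset α), U.card = m →
      (∀ u ∈ U, r ≤ (S.filter (R u)).card) →
      (∀ s ∈ S, (U.filter (R · s)).card ≤ d + 1) →
      ∃ T ⊆ S, (∀ u ∈ U, ∃ s ∈ T, R u s) ∧
        (T.card : ℝ) ≤
          (U.card : ℝ) / (d + 1) + (S.card : ℝ) / r * ((harmonic (d + 1) : ℝ) - 1) := by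
  induction d with
  | zero =>
    intro m
    induction m using Nat.strong_induction_on with
    | _ m ih =>
      intro U hm hU hS
      rcases U.eq_empty_or_nonempty with rfl | ⟨u, hu⟩
      · exact ⟨∅, by simp, by simp, by simp [harmonic]⟩
      · obtain ⟨s, hs⟩ := Finset.card_pos.1 (hr.trans_le (hU u hu))
        obtain ⟨hsS, hus⟩ := Finset.mem_filter.1 hs
        have hlt : (U.erase u).card < m := hm ▸ Finset.card_erase_lt_of_mem hu
        obtain ⟨T, hTS, hT, hc⟩ := ih _ hlt (U.erase u) rfl
          (fun v hv => hU v (Finset.mem_of_mem_erase hv))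
          (fun t ht => (Finset.card_le_card
            (Finset.filter_subset_filter _ (Finset.erase_subset _ _))).trans (hS t ht))
        refine ⟨insert s T, Finset.insert_subset hsS hTS, fun v hv => ?_, ?_⟩
        · by_cases h : v = u
          · exact ⟨s, by simp, h ▸ hus⟩
          · obtain ⟨t, ht, hvt⟩ := hT v (Finset.mem_erase.2 ⟨h, hv⟩)
            exact ⟨t, Finset.mem_insert_of_mem ht, hvt⟩
        · have h1 : ((insert s T).card : ℝ) ≤ T.card + 1 := by
            exact_mod_cast Finset.card_insert_le s T
          have h2 : ((U.erase u).card : ℝ) + 1 = U.card := by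
            exact_mod_cast Finset.card_erase_add_one hu
          norm_num [harmonic] at hc ⊢
          have hc' : (T.card : ℝ) ≤ (U.erase u).card := by exact_mod_cast hc
          exact_mod_cast (by linarith : ((insert s T).card : ℝ) ≤ U.card)
  | succ d ihd =>
    intro m
    induction m using Nat.strong_induction_on with
    | _ m ih =>
      intro U hm hU hS
      by_cases hmax : ∃ s ∈ S, (U.filter (R · s)).card = d + 1 + 1
      · obtain ⟨s, hsS, hsc⟩ := hmax
        have hsplit := Finset.card_filter_add_card_filter_not (s := U) (R · s)
        obtain ⟨T, hTS, hT, hc⟩ := ih _ (by omega) (U.filter (¬ R · s)) rfl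
          (fun v hv => hU v (Finset.mem_filter.1 hv).1)
          (fun t ht => (Finset.card_le_card
            (Finset.filter_subset_filter _ (Finset.filter_subset _ _))).trans (hS t ht))
        refine ⟨insert s T, Finset.insert_subset hsS hTS, fun v hv => ?_, ?_⟩
        · by_cases h : R v s
          · exact ⟨s, by simp, h⟩
          · obtain ⟨t, ht, hvt⟩ := hT v (Finset.mem_filter.2 ⟨hv, h⟩)
            exact ⟨t, Finset.mem_insert_of_mem ht, hvt⟩
        · have h1 : ((insert s T).card : ℝ) ≤ T.card + 1 := by
            exact_mod_cast Finset.card_insert_le s T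
          have h2 : (U.card : ℝ) = (d + 1 + 1) + (U.filter (¬ R · s)).card := by
            rw [← hsplit, hsc]; push_cast; ring
          have h3 : (U.card : ℝ) / ((d + 1 : ℕ) + 1)
              = 1 + ((U.filter (¬ R · s)).card : ℝ) / ((d + 1 : ℕ) + 1) := by
            rw [h2]; push_cast; field_simp
          linarith
      · push Not at hmax
        have hS' : ∀ s ∈ S, (U.filter (R · s)).card ≤ d + 1 := fun s hs => by
          have := hS s hs
          have := hmax s hs
          omega
        obtain ⟨T, hTS, hT, hc⟩ := ihd m U hm hU hS'
        refine ⟨T, hTS, hT, hc.trans ?_⟩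
        have hdc : (U.card : ℝ) * r ≤ S.card * (d + 1) := by
          exact_mod_cast Finset.card_mul_le_card_mul R hU hS'
        have hr' : (0 : ℝ) < r := by exact_mod_cast hr
        have hh : (harmonic (d + 1 + 1) : ℝ) = harmonic (d + 1) + ((d : ℝ) + 1 + 1)⁻¹ := by
          rw [harmonic_succ]; push_cast; rfl
        have hUr : (U.card : ℝ) / (d + 1) ≤ S.card / r := by
          rw [div_le_div_iff₀ (by positivity) hr']; exact hdc
        have key : (U.card : ℝ) / (d + 1)
            = U.card / (d + 1 + 1) + U.card / (d + 1) * ((d : ℝ) + 1 + 1)⁻¹ := by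
          field_simp
        have := mul_le_mul_of_nonneg_right hUr (by positivity : (0 : ℝ) ≤ ((d : ℝ) + 1 + 1)⁻¹)
        rw [hh]; push_cast
        nlinarith

open Classical in
/-- The Lovász–Stein covering theorem. -/
theorem exists_cover_card_le_one_add_log {α β : Type*} (R : α → β → Prop) (U : Finset α)
    (S : Finset β) (r d : ℕ) (hr : 0 < r) (hd : 0 < d)
    (hU : ∀ u ∈ U, r ≤ (S.filter (R u)).card)
    (hS : ∀ s ∈ S, (U.filter (R · s)).card ≤ d) :
    ∃ T ⊆ S, (∀ u ∈ U, ∃ s ∈ T, R u s) ∧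
      (T.card : ℝ) ≤ (S.card : ℝ) / r * (1 + Real.log d) := by
  obtain ⟨d, rfl⟩ := Nat.exists_eq_succ_of_ne_zero hd.ne'
  obtain ⟨T, hTS, hT, hc⟩ := exists_cover_card_le_of_fiber_bounds R S r hr d _ U rfl hU hS
  refine ⟨T, hTS, hT, hc.trans ?_⟩
  have hr' : (0 : ℝ) < r := by exact_mod_cast hr
  have hdc : (U.card : ℝ) * r ≤ S.card * (d + 1) := by
    exact_mod_cast Finset.card_mul_le_card_mul R hU hS
  have hUr : (U.card : ℝ) / (d + 1) ≤ S.card / r := by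
    rw [div_le_div_iff₀ (by positivity) hr']; exact hdc
  have hlog := mul_le_mul_of_nonneg_left (harmonic_le_one_add_log (d + 1))
    (by positivity : (0 : ℝ) ≤ S.card / r)
  rw [Nat.succ_eq_add_one]
  linarith

open Classical in
/-- A matching with `k` edges has at least `2 ^ k` transversals of size `k`. -/
theorem two_pow_le_card_transversals {V : Type*} [Fintype V] [DecidableEq V] {k : ℕ}
    (M : Finset (Finset V)) (h2 : ∀ e ∈ M, e.card = 2)
    (hdisj : ∀ e ∈ M, ∀ f ∈ M, e ≠ f → Disjoint e f) (hM : M.card = k) :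
    2 ^ k ≤ ((Finset.powersetCard k (Finset.univ : Finset V)).filter
      (fun X => ∀ e ∈ M, (e ∩ X).card = 1)).card := by
  have hab : ∀ e : M, ∃ a b, a ≠ b ∧ (e : Finset V) = {a, b} :=
    fun e => Finset.card_eq_two.1 (h2 e e.2)
  choose a b hne heq using hab
  have huniq : ∀ (e f : M) (x : V), x ∈ (e : Finset V) → x ∈ (f : Finset V) → e = f := by
    intro e f x hxe hxf
    by_contra h
    exact Finset.disjoint_left.1
      (hdisj e e.2 f f.2 (fun h' => h (Subtype.ext h'))) hxe hxf
  let sel : Finset M → M → V := fun W e => if e ∈ W then a e else b e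
  have hsel : ∀ W (e : M), sel W e ∈ (e : Finset V) := by
    intro W e
    rw [heq e]
    by_cases h : e ∈ W <;> simp [sel, h]
  let F : Finset M → Finset V := fun W => Finset.univ.image (sel W)
  have hinter : ∀ W (e : M), (e : Finset V) ∩ F W = {sel W e} := by
    intro W e
    ext x
    simp only [F, Finset.mem_inter, Finset.mem_image, Finset.mem_univ, true_and,
      Finset.mem_singleton]
    constructor
    · rintro ⟨hx, f, rfl⟩
      rw [huniq e f _ hx (hsel W f)]
    · rintro rfl
      exact ⟨hsel W e, e, rfl⟩
  have hinj : Function.Injective F := by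
    intro W W' h
    ext e
    have h1 : sel W e = sel W' e := by
      rw [← Finset.singleton_inj, ← hinter, ← hinter, h]
    have h2 := hne e
    simp only [sel] at h1
    split_ifs at h1 <;> tauto
  have hcard : (Finset.univ : Finset (Finset M)).card = 2 ^ k := by
    simp [hM]
  rw [← hcard]
  refine Finset.card_le_card_of_injOn F (fun W _ => ?_) hinj.injOn
  simp only [Finset.coe_filter, Set.mem_ofPred_eq, Finset.mem_powersetCard_univ]
  refine ⟨?_, fun e he => ?_⟩
  · rw [Finset.card_image_of_injective, Finset.card_univ, Fintype.card_coe, hM]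
    intro e f hef
    exact huniq e f _ (hsel W e) (hef ▸ hsel W f)
  · rw [hinter W ⟨e, he⟩, Finset.card_singleton]

open Classical in
/-- A `k`-set is a transversal of at most `|V| ^ k` matchings with `k` edges. -/
theorem card_matchings_of_transversal_le {V : Type*} [Fintype V] [DecidableEq V] {k : ℕ}
    (X : Finset V) (hX : X.card = k) (U : Finset (Finset (Finset V)))
    (hU : ∀ M ∈ U, (∀ e ∈ M, e.card = 2) ∧
      (∀ e ∈ M, ∀ f ∈ M, e ≠ f → Disjoint e f) ∧ M.card = k) :
    (U.filter (fun M => ∀ e ∈ M, (e ∩ X).card = 1)).card ≤ Fintype.card V ^ k := by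
  let G : (X → V) → Finset (Finset V) := fun f =>
    Finset.univ.image (fun x : X => {(x : V), f x})
  have hsub : U.filter (fun M => ∀ e ∈ M, (e ∩ X).card = 1) ⊆ Finset.univ.image G := by
    intro M hM
    obtain ⟨hMU, htrans⟩ := Finset.mem_filter.1 hM
    obtain ⟨h2, hdisj, hMk⟩ := hU M hMU
    let f : X → V := fun x => if h : ∃ y, {(x : V), y} ∈ M then h.choose else x
    refine Finset.mem_image.2 ⟨f, Finset.mem_univ _, ?_⟩
    symm
    refine Finset.eq_of_subset_of_card_le (fun e he => ?_) ?_
    · obtain ⟨x, hx⟩ := Finset.card_eq_one.1 (htrans e he)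
      obtain ⟨hxe, hxX⟩ := Finset.mem_inter.1 (hx ▸ Finset.mem_singleton_self x)
      have hy : ∃ y, {x, y} = e := by
        obtain ⟨a, b, -, rfl⟩ := Finset.card_eq_two.1 (h2 e he)
        rcases Finset.mem_insert.1 hxe with rfl | h
        · exact ⟨b, rfl⟩
        · rw [Finset.mem_singleton.1 h]
          exact ⟨a, Finset.pair_comm _ _⟩
      have hex : ∃ y, {x, y} ∈ M := by
        obtain ⟨y, h⟩ := hy
        exact ⟨y, h ▸ he⟩
      refine Finset.mem_image.2 ⟨⟨x, hxX⟩, Finset.mem_univ _, ?_⟩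
      have hf : f ⟨x, hxX⟩ = hex.choose := dif_pos hex
      rw [hf]
      by_contra hcon
      exact Finset.disjoint_left.1 (hdisj _ hex.choose_spec e he hcon)
        (Finset.mem_insert_self _ _) hxe
    · calc (G f).card ≤ (Finset.univ : Finset X).card := Finset.card_image_le
        _ = M.card := by rw [Finset.card_univ, Fintype.card_coe, hX, hMk]
  calc _ ≤ (Finset.univ.image G).card := Finset.card_le_card hsub
    _ ≤ (Finset.univ : Finset (X → V)).card := Finset.card_image_le
    _ = Fintype.card V ^ k := by simp [hX]



/-- For every `n ≥ 2` and `1 ≤ k ≤ ⌊n/2⌋` there is a family `T` of `k`-subsets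
of `[n]`, of size at most `(1 + k ln n)·2^{-k}·C(n,k)`, such that every matching
of size `k` on `K_n` is *compatible* with some `X ∈ T` (each edge of the
matching has exactly one endpoint in `X`). -/
theorem stmt1 (n k : ℕ) (hn : 2 ≤ n) (hk : 1 ≤ k) (hkn : k ≤ n / 2) :
    ∃ T : Finset (Finset (Fin n)),
      (∀ X ∈ T, X.card = k) ∧
      (T.card : ℝ) ≤ (1 + (k : ℝ) * Real.log n) / 2 ^ k * (n.choose k) ∧
      ∀ M : Finset (Finset (Fin n)),
        (∀ e ∈ M, e.card = 2) →
        (∀ e ∈ M, ∀ f ∈ M, e ≠ f → Disjoint e f) →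
        M.card = k →
        ∃ X ∈ T, ∀ e ∈ M, (e ∩ X).card = 1 := by
  classical
  let U : Finset (Finset (Finset (Fin n))) := Finset.univ.filter fun M =>
    (∀ e ∈ M, e.card = 2) ∧ (∀ e ∈ M, ∀ f ∈ M, e ≠ f → Disjoint e f) ∧ M.card = k
  have hmem : ∀ M ∈ U, (∀ e ∈ M, e.card = 2) ∧
      (∀ e ∈ M, ∀ f ∈ M, e ≠ f → Disjoint e f) ∧ M.card = k :=
    fun M hM => (Finset.mem_filter.1 hM).2
  obtain ⟨T, hTS, hT, hc⟩ := exists_cover_card_le_one_add_log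
    (fun (M : Finset (Finset (Fin n))) X => ∀ e ∈ M, (e ∩ X).card = 1) U
    (Finset.powersetCard k Finset.univ) (2 ^ k) (n ^ k) (by positivity) (by positivity)
    (fun M hM => by
      obtain ⟨h2, hdisj, hMk⟩ := hmem M hM
      convert two_pow_le_card_transversals M h2 hdisj hMk)
    (fun X hX => by
      have h := card_matchings_of_transversal_le X (Finset.mem_powersetCard_univ.1 hX) U hmem
      rw [Fintype.card_fin] at h
      convert h)
  refine ⟨T, fun X hX => Finset.mem_powersetCard_univ.1 (hTS hX), ?_, fun M h2 hdisj hMk =>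
    hT M (Finset.mem_filter.2 ⟨Finset.mem_univ _, h2, hdisj, hMk⟩)⟩
  refine hc.trans_eq ?_
  rw [Finset.card_powersetCard, Finset.card_univ, Fintype.card_fin]
  push_cast
  rw [Real.log_pow]
  ring
end
end

section
/- Fix n ≥ 2 and k with 1 ≤ k ≤ ⌊n/2⌋. Consider the hypergraph H_k whose vertex set is the family 𝒳_k of all k-element subsets of [n], whose edge set is the family ℳ_k of all matchings of size k on the complete graph K_n, and where a vertex X ∈ 𝒳_k belongs to an edge M ∈ ℳ_k if and only if every edge of M has exactly one endpoint in X. Then the fractional cover number of H_k equals exactly 2^{−k} · C(n, k). -/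
open Finset in
/-- There are exactly `2 ^ k` sets of size `k` meeting each of `k` disjoint pairs in one point. -/
theorem card_transversals {α : Type*} [Fintype α] [DecidableEq α] {k : ℕ}
    (M : Finset (Finset α)) (h2 : ∀ e ∈ M, e.card = 2)
    (hd : ∀ e ∈ M, ∀ f ∈ M, e ≠ f → Disjoint e f) (hM : M.card = k) :
    ((powersetCard k (univ : Finset α)).filter
      (fun X => ∀ e ∈ M, (e ∩ X).card = 1)).card = 2 ^ k := by
  have hinj (f : (e : M) → e.1) : Function.Injective (fun e : M => (f e : α)) := by
    intro a b hab
    by_contra hne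
    have hdis := hd a a.2 b b.2 (fun h => hne (Subtype.ext h))
    exact disjoint_left.1 hdis (f a).2 (by
      have := (f b).2
      simp only at hab
      rwa [← hab] at this)
  have hinter (f : (e : M) → e.1) (e : M) :
      e.1 ∩ univ.image (fun e : M => (f e : α)) = {(f e : α)} := by
    ext x
    simp only [mem_inter, mem_image, mem_univ, true_and, mem_singleton]
    constructor
    · rintro ⟨hx, a, rfl⟩
      by_contra hne
      have hae : a.1 ≠ e.1 := fun h => hne (by rw [Subtype.ext h])
      exact disjoint_left.1 (hd a a.2 e e.2 hae) (f a).2 hx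
    · rintro rfl
      exact ⟨(f e).2, e, rfl⟩
  have hcard : Fintype.card ((e : M) → e.1) = 2 ^ k := by
    have he (e : M) : Fintype.card e.1 = 2 := (Fintype.card_coe e.1).trans (h2 e.1 e.2)
    simp only [Fintype.card_pi, he, prod_const, card_univ, Fintype.card_coe, hM]
  rw [← hcard, ← card_univ]
  symm
  refine card_bij (fun f _ => univ.image (fun e : M => (f e : α))) ?_ ?_ ?_
  · intro f _
    simp only [mem_filter, mem_powersetCard, subset_univ, true_and]
    refine ⟨?_, fun e he => ?_⟩
    · rw [card_image_of_injective _ (hinj f)]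
      simp [hM]
    · rw [hinter f ⟨e, he⟩, card_singleton]
  · intro f _ g _ hfg
    funext e
    have h := hinter f e
    rw [hfg, hinter g e] at h
    exact Subtype.ext (singleton_injective h).symm
  · intro X hX
    simp only [mem_filter, mem_powersetCard, subset_univ, true_and] at hX
    have hx (e : M) : ∃ x : e.1, (x : α) ∈ X := by
      obtain ⟨x, hx⟩ := card_eq_one.1 (hX.2 e e.2)
      have : x ∈ e.1 ∩ X := hx ▸ mem_singleton_self x
      exact ⟨⟨x, (mem_inter.1 this).1⟩, (mem_inter.1 this).2⟩
    choose f hf using hx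
    refine ⟨f, mem_univ _, eq_of_subset_of_card_le ?_ ?_⟩
    · intro x hx
      obtain ⟨e, -, rfl⟩ := mem_image.1 hx
      exact hf e
    · rw [card_image_of_injective _ (hinj f), hX.1]
      simp [hM]

open Finset in
/-- Averaging over all permutations of `α` spreads a `k`-subset uniformly over all `k`-subsets. -/
theorem choose_mul_sum_perm {α : Type*} [Fintype α] [DecidableEq α] {k : ℕ}
    (t : Finset α → ℝ) {Y : Finset α} (hY : Y.card = k) :
    ((Fintype.card α).choose k : ℝ) * ∑ σ : Equiv.Perm α, t (Y.map σ.toEmbedding) =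
      (Fintype.card (Equiv.Perm α) : ℝ) * ∑ X ∈ powersetCard k (univ : Finset α), t X := by
  have hconst : ∀ X ∈ powersetCard k (univ : Finset α),
      ∑ σ : Equiv.Perm α, t (X.map σ.toEmbedding) =
        ∑ σ : Equiv.Perm α, t (Y.map σ.toEmbedding) := by
    intro X hX
    have hXY : Y.card = X.card := hY.trans (mem_powersetCard.1 hX).2.symm
    let τ : Equiv.Perm α := (Finset.equivOfCardEq hXY).extendSubtype
    have hτ : Y.map τ.toEmbedding = X := by
      refine eq_of_subset_of_card_le ?_ (by rw [card_map, hXY])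
      intro x hx
      obtain ⟨y, hy, rfl⟩ := mem_map.1 hx
      exact (Finset.equivOfCardEq hXY).extendSubtype_mem y hy
    refine Fintype.sum_equiv (Equiv.mulRight τ) _ _ fun σ => ?_
    rw [← hτ, map_map]
    rfl
  have hperm (σ : Equiv.Perm α) :
      ∑ X ∈ powersetCard k (univ : Finset α), t (X.map σ.toEmbedding) =
        ∑ X ∈ powersetCard k (univ : Finset α), t X := by
    refine sum_bij' (fun X _ => X.map σ.toEmbedding) (fun X _ => X.map σ.symm.toEmbedding)
      ?_ ?_ ?_ ?_ ?_ <;> simp +contextual [mem_powersetCard, map_map]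
  calc _ = ∑ X ∈ powersetCard k (univ : Finset α),
        ∑ σ : Equiv.Perm α, t (X.map σ.toEmbedding) := by
        rw [sum_congr rfl hconst, sum_const, card_powersetCard, card_univ, nsmul_eq_mul]
    _ = _ := by
        rw [sum_comm, sum_congr rfl (fun σ _ => hperm σ), sum_const, card_univ, nsmul_eq_mul]

open Finset in
/-- The complete graph on `n ≥ 2 * k` vertices has a matching of size `k`. -/
theorem exists_matching_card {n k : ℕ} (h : 2 * k ≤ n) :
    ∃ M : Finset (Finset (Fin n)), (∀ e ∈ M, e.card = 2) ∧
      (∀ e ∈ M, ∀ f ∈ M, e ≠ f → Disjoint e f) ∧ M.card = k := by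
  let g : Fin k → Finset (Fin n) := fun i =>
    {⟨2 * i.1, by omega⟩, ⟨2 * i.1 + 1, by omega⟩}
  have hg (i j : Fin k) (hij : i ≠ j) : Disjoint (g i) (g j) := by
    have : i.1 ≠ j.1 := fun h => hij (Fin.ext h)
    simp only [g, disjoint_insert_left, disjoint_singleton_left, mem_insert, mem_singleton,
      Fin.mk.injEq]
    omega
  have hg2 (i : Fin k) : (g i).card = 2 := card_pair (by simp)
  refine ⟨univ.image g, ?_, ?_, ?_⟩
  · simp [hg2]
  · simp only [mem_image, mem_univ, true_and]
    rintro _ ⟨i, rfl⟩ _ ⟨j, rfl⟩ hij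
    exact hg i j (fun h => hij (by rw [h]))
  · rw [card_image_of_injective, card_univ, Fintype.card_fin]
    intro i j hij
    by_contra hne
    have h1 := hg i j hne
    rw [hij, disjoint_self_iff_empty] at h1
    have h2 := hg2 j
    simp [h1] at h2

open Finset in
/-- Every fractional cover of the size-`k` matchings has total weight at least `C(n, k) / 2 ^ k`. -/
theorem choose_div_le_sum_of_cover {n k : ℕ} (hkn : 2 * k ≤ n) (t : Finset (Fin n) → ℝ)
    (ht : ∀ M : Finset (Finset (Fin n)), (∀ e ∈ M, e.card = 2) →
      (∀ e ∈ M, ∀ f ∈ M, e ≠ f → Disjoint e f) → M.card = k →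
      1 ≤ ∑ X ∈ (powersetCard k (univ : Finset (Fin n))).filter
        (fun X => ∀ e ∈ M, (e ∩ X).card = 1), t X) :
    (n.choose k : ℝ) / 2 ^ k ≤ ∑ X ∈ powersetCard k (univ : Finset (Fin n)), t X := by
  obtain ⟨M, h2, hd, hM⟩ := exists_matching_card hkn
  set T := (powersetCard k (univ : Finset (Fin n))).filter
    (fun X => ∀ e ∈ M, (e ∩ X).card = 1) with hT
  have hσ (σ : Equiv.Perm (Fin n)) : 1 ≤ ∑ Y ∈ T, t (Y.map σ.toEmbedding) := by
    have h := ht (M.map (mapEmbedding σ.toEmbedding).toEmbedding) (by simpa using h2) ?_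
      (by rw [card_map, hM])
    · refine h.trans_eq ?_
      symm
      refine sum_bij' (fun X _ => X.map σ.toEmbedding) (fun X _ => X.map σ.symm.toEmbedding)
        ?_ ?_ ?_ ?_ ?_
      · intro X hX
        simp only [hT, mem_filter, mem_powersetCard, subset_univ, true_and] at hX
        simpa [mem_powersetCard, ← map_inter] using hX
      · intro X hX
        simp only [mem_filter, mem_powersetCard, subset_univ, true_and, mem_map,
          forall_exists_index, and_imp] at hX
        simp only [hT, mem_filter, mem_powersetCard, subset_univ, true_and, card_map]
        refine ⟨hX.1, fun e he => ?_⟩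
        rw [← hX.2 _ e he rfl, ← card_map σ.toEmbedding, map_inter]
        simp [map_map]
      · simp [map_map]
      · simp [map_map]
      · simp
    · simp only [mem_map]
      rintro _ ⟨e, he, rfl⟩ _ ⟨f, hf, rfl⟩ hef
      exact (disjoint_map _).2 (hd e he f hf (fun h => hef (by rw [h])))
  have hTcard : T.card = 2 ^ k := card_transversals M h2 hd hM
  have hN : (0 : ℝ) < Fintype.card (Equiv.Perm (Fin n)) := by
    exact_mod_cast Fintype.card_pos
  have hsum : (Fintype.card (Equiv.Perm (Fin n)) : ℝ) ≤
      ∑ Y ∈ T, ∑ σ : Equiv.Perm (Fin n), t (Y.map σ.toEmbedding) := by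
    rw [sum_comm]
    simpa using sum_le_sum (fun σ (_ : σ ∈ univ) => hσ σ)
  have hmul : (n.choose k : ℝ) * ∑ Y ∈ T, ∑ σ : Equiv.Perm (Fin n), t (Y.map σ.toEmbedding) =
      2 ^ k * (Fintype.card (Equiv.Perm (Fin n)) *
        ∑ X ∈ powersetCard k (univ : Finset (Fin n)), t X) := by
    rw [mul_sum, sum_congr rfl (g := fun _ => (Fintype.card (Equiv.Perm (Fin n)) : ℝ) *
        ∑ X ∈ powersetCard k (univ : Finset (Fin n)), t X), sum_const, hTcard, nsmul_eq_mul]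
    · push_cast
      rfl
    · intro Y hY
      have := choose_mul_sum_perm t (mem_powersetCard.1 (mem_filter.1 hY).1).2
      rwa [Fintype.card_fin] at this
  have hle := mul_le_mul_of_nonneg_left hsum (Nat.cast_nonneg (α := ℝ) (n.choose k))
  rw [hmul] at hle
  rw [div_le_iff₀ (by positivity)]
  refine le_of_mul_le_mul_right ?_ hN
  linarith


noncomputable section

/-- The fractional cover number of the hypergraph `H_k` — vertices: `k`-subsets
`X` of `[n]`; edges: matchings `M` of size `k` on `K_n`, where `X ∈ M` iff every
edge of `M` has exactly one endpoint in `X` — equals `2^{-k}·C(n,k)`. -/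
theorem stmt2 (n k : ℕ) (hn : 2 ≤ n) (hk : 1 ≤ k) (hkn : k ≤ n / 2) :
    sInf {s : ℝ | ∃ t : Finset (Fin n) → ℝ,
        (∀ X ∈ Finset.powersetCard k (Finset.univ : Finset (Fin n)), 0 ≤ t X) ∧
        (∀ M : Finset (Finset (Fin n)),
          (∀ e ∈ M, e.card = 2) →
          (∀ e ∈ M, ∀ f ∈ M, e ≠ f → Disjoint e f) →
          M.card = k →
          1 ≤ ∑ X ∈ (Finset.powersetCard k (Finset.univ : Finset (Fin n))).filter
                (fun X => ∀ e ∈ M, (e ∩ X).card = 1), t X) ∧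
        s = ∑ X ∈ Finset.powersetCard k (Finset.univ : Finset (Fin n)), t X}
      = (n.choose k : ℝ) / 2 ^ k := by
  have h2k : 2 * k ≤ n := by omega
  refine IsLeast.csInf_eq ⟨⟨fun _ => 1 / 2 ^ k, fun _ _ => by positivity, ?_, ?_⟩, ?_⟩
  · intro M h2 hd hM
    rw [Finset.sum_const, card_transversals M h2 hd hM, nsmul_eq_mul]
    push_cast
    rw [mul_one_div_cancel (by positivity)]
  · rw [Finset.sum_const, Finset.card_powersetCard, Finset.card_univ, Fintype.card_fin,
      nsmul_eq_mul, mul_one_div]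
  · rintro s ⟨t, -, ht, rfl⟩
    exact choose_div_le_sum_of_cover h2k t ht
end
end

section
/- Let n ≥ 1 and let C = ((i_0, j_0), …, (i_{q−1}, j_{q−1})) be a sequence of coordinate pairs in [n]² with i_l < j_l, and let σ⁺_C := σ⁺_{i_{q−1},j_{q−1}} ∘ ⋯ ∘ σ⁺_{i_0,j_0} be the corresponding composition of conditional reflections. Then the following are equivalent: (i) for every x ∈ ℝⁿ, σ⁺_C(x) = x̄, the nondecreasing rearrangement of x; (ii) for every permutation σ of [n], σ⁺_C(x_σ) = (1, 2, …, n); (iii) for every J ⊆ [n], σ⁺_C(χ_J) = χ_{J_f}, where J_f = {n − |J| + 1, …, n}. -/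
noncomputable section

/-- Conditional reflection `σ⁺_{i,j}`: replaces `(x i, x j)` by `(min, max)`. -/
def sigP {n : ℕ} (i j : Fin n) (x : Fin n → ℝ) : Fin n → ℝ :=
  fun k => if k = i then min (x i) (x j) else if k = j then max (x i) (x j) else x k

/-- `σ⁺_C = σ⁺_{i_{q-1},j_{q-1}} ∘ ⋯ ∘ σ⁺_{i_0,j_0}`. -/
def netP {n : ℕ} (C : List (Fin n × Fin n)) (x : Fin n → ℝ) : Fin n → ℝ :=
  C.foldl (fun y p => sigP p.1 p.2 y) x

/-- Characteristic vector of `J ⊆ [n]`. -/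
def chi {n : ℕ} (J : Finset (Fin n)) : Fin n → ℝ :=
  fun k => if k ∈ J then 1 else 0

/-- The vector `x_σ = (σ(1), …, σ(n))`. -/
def permVec {n : ℕ} (σ : Equiv.Perm (Fin n)) : Fin n → ℝ :=
  fun k => ((σ k : ℕ) : ℝ) + 1

theorem sigP_comp_monotone {n : ℕ} {f : ℝ → ℝ} (hf : Monotone f) (i j : Fin n) (x : Fin n → ℝ) :
    sigP i j (f ∘ x) = f ∘ sigP i j x := by
  funext k
  simp only [sigP, Function.comp_apply]
  split_ifs
  · exact hf.map_min.symm
  · exact hf.map_max.symm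
  · rfl

theorem netP_comp_monotone {n : ℕ} {f : ℝ → ℝ} (hf : Monotone f) (C : List (Fin n × Fin n))
    (x : Fin n → ℝ) : netP C (f ∘ x) = f ∘ netP C x := by
  induction C generalizing x with
  | nil => rfl
  | cons p C ih =>
    change netP C (sigP p.1 p.2 (f ∘ x)) = f ∘ netP C (sigP p.1 p.2 x)
    rw [sigP_comp_monotone hf, ih]

theorem exists_perm_sigP_eq {n : ℕ} (i j : Fin n) (x : Fin n → ℝ) :
    ∃ π : Equiv.Perm (Fin n), sigP i j x = x ∘ π := by
  rcases le_total (x i) (x j) with h | h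
  · refine ⟨1, funext fun k => ?_⟩
    simp only [sigP, min_eq_left h, max_eq_right h, Function.comp_apply, Equiv.Perm.one_apply]
    split_ifs <;> simp_all
  · refine ⟨Equiv.swap i j, funext fun k => ?_⟩
    simp only [sigP, min_eq_right h, max_eq_left h, Function.comp_apply, Equiv.swap_apply_def]
    split_ifs <;> simp_all

theorem exists_perm_netP_eq {n : ℕ} (C : List (Fin n × Fin n)) (x : Fin n → ℝ) :
    ∃ π : Equiv.Perm (Fin n), netP C x = x ∘ π := by
  induction C generalizing x with
  | nil => exact ⟨1, rfl⟩
  | cons p C ih =>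
    obtain ⟨π, hπ⟩ := exists_perm_sigP_eq p.1 p.2 x
    obtain ⟨ρ, hρ⟩ := ih (sigP p.1 p.2 x)
    exact ⟨π * ρ, hρ.trans (by rw [hπ]; rfl)⟩

/-- A monotone output of a network is the unique monotone rearrangement of the input. -/
theorem netP_eq_of_monotone {n : ℕ} {C : List (Fin n × Fin n)} {x y : Fin n → ℝ}
    (h : Monotone (netP C x)) (hy : Monotone y) (hxy : ∃ π : Equiv.Perm (Fin n), y = x ∘ π) :
    netP C x = y := by
  obtain ⟨π, hπ⟩ := exists_perm_netP_eq C x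
  obtain ⟨ρ, rfl⟩ := hxy
  rw [hπ] at h ⊢
  rw [Tuple.comp_sort_eq_comp_iff_monotone.mpr h, Tuple.comp_sort_eq_comp_iff_monotone.mpr hy]

/-- Characteristic vectors of sets of the same size are rearrangements of each other. -/
theorem exists_perm_chi_eq {n : ℕ} {J K : Finset (Fin n)} (h : K.card = J.card) :
    ∃ π : Equiv.Perm (Fin n), chi K = chi J ∘ π := by
  let e : {k // k ∈ K} ≃ {k // k ∈ J} := Finset.equivOfCardEq h
  refine ⟨e.extendSubtype, funext fun k => ?_⟩
  by_cases hk : k ∈ K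
  · simp [chi, hk, e.extendSubtype_mem k hk]
  · simp [chi, hk, e.extendSubtype_not_mem k hk]

theorem card_filter_sub_le {n m : ℕ} (hm : m ≤ n) :
    (Finset.univ.filter fun k : Fin n => n - m ≤ (k : ℕ)).card = m := by
  have h := Fin.card_filter_val_lt (n := n) (m := n - m)
  have h' := Finset.card_filter_add_card_filter_not (s := Finset.univ)
    (fun k : Fin n => (k : ℕ) < n - m)
  simp only [not_lt, Finset.card_univ, Fintype.card_fin] at h'
  omega

theorem monotone_ite_le {α : Type*} [LinearOrder α] (c : α) :
    Monotone fun t : α => if c ≤ t then (1 : ℝ) else 0 := by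
  intro a b hab
  by_cases ha : c ≤ a
  · simp [ha, ha.trans hab]
  · simp only [ha, if_false]
    split_ifs <;> norm_num

/-- Every monotone vector is the image of `(1, …, n)` under a monotone function. -/
theorem exists_monotone_extension {n : ℕ} (hn : 1 ≤ n) {y : Fin n → ℝ} (hy : Monotone y) :
    ∃ f : ℝ → ℝ, Monotone f ∧ ∀ k : Fin n, f (((k : ℕ) : ℝ) + 1) = y k := by
  refine ⟨fun t => y ⟨min (⌊t⌋₊ - 1) (n - 1), by omega⟩, fun a b hab => hy ?_, fun k => ?_⟩
  · have := Nat.floor_mono hab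
    simp only [Fin.mk_le_mk]
    omega
  · refine congrArg y (Fin.ext ?_)
    have : ⌊((k : ℕ) : ℝ) + 1⌋₊ = (k : ℕ) + 1 := by
      exact_mod_cast Nat.floor_natCast (R := ℝ) ((k : ℕ) + 1)
    simp only [this]
    omega

theorem monotone_netP_iff_permVec {n : ℕ} (hn : 1 ≤ n) (C : List (Fin n × Fin n)) :
    (∀ x : Fin n → ℝ, Monotone (netP C x)) ↔
      ∀ σ : Equiv.Perm (Fin n), netP C (permVec σ) = fun k : Fin n => ((k : ℕ) : ℝ) + 1 := by
  constructor
  · intro h σ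
    refine netP_eq_of_monotone (h _) (fun a b hab => ?_) ⟨σ⁻¹, funext fun k => ?_⟩
    · have : (a : ℕ) ≤ b := hab
      simpa using this
    · simp [permVec]
  · intro h x
    have hy := Tuple.monotone_sort x
    obtain ⟨f, hf, hfy⟩ := exists_monotone_extension hn hy
    have hx : x = f ∘ permVec (Tuple.sort x)⁻¹ := by
      funext k
      simp [permVec, hfy]
    rw [hx, netP_comp_monotone hf, h]
    intro a b hab
    simpa only [Function.comp_apply, hfy] using hy hab

theorem monotone_netP_iff_chi {n : ℕ} (C : List (Fin n × Fin n)) :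
    (∀ x : Fin n → ℝ, Monotone (netP C x)) ↔
      ∀ J : Finset (Fin n),
        netP C (chi J) = fun k : Fin n => if n - J.card ≤ (k : ℕ) then (1 : ℝ) else 0 := by
  constructor
  · intro h J
    refine netP_eq_of_monotone (h _) (fun a b hab => monotone_ite_le (n - J.card) hab) ?_
    have hJ : J.card ≤ n := by simpa using J.card_le_univ
    obtain ⟨π, hπ⟩ := exists_perm_chi_eq (card_filter_sub_le hJ)
    exact ⟨π, by rw [← hπ]; funext k; simp [chi]⟩
  · intro h x a b hab
    let c := netP C x a
    let J := Finset.univ.filter fun k => c ≤ x k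
    have hx : chi J = (fun t : ℝ => if c ≤ t then (1 : ℝ) else 0) ∘ x := by
      funext k
      simp [chi, J]
    have hJ := h J
    rw [hx, netP_comp_monotone (monotone_ite_le c)] at hJ
    have hle : (if c ≤ netP C x a then (1 : ℝ) else 0) ≤ if c ≤ netP C x b then 1 else 0 := by
      have ha := congrFun hJ a
      have hb := congrFun hJ b
      simp only [Function.comp_apply] at ha hb
      rw [ha, hb]
      exact monotone_ite_le (n - J.card) hab
    by_contra hlt
    norm_num [c, hlt] at hle

/-- Equivalence of the three definitions of a sorting network:
(i) every vector is mapped to its nondecreasing rearrangement;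
(ii) every permutation vector is mapped to `(1,…,n)`;
(iii) every characteristic vector `χ_J` is mapped to `χ_{J_f}`, `J_f = {n-|J|+1,…,n}`. -/
theorem stmt3 (n : ℕ) (hn : 1 ≤ n) (C : List (Fin n × Fin n))
    (hC : ∀ p ∈ C, p.1 < p.2) :
    ((∀ x : Fin n → ℝ, Monotone (netP C x) ∧
        ∃ π : Equiv.Perm (Fin n), netP C x = x ∘ π)
      ↔ (∀ σ : Equiv.Perm (Fin n), netP C (permVec σ) = fun k : Fin n => ((k : ℕ) : ℝ) + 1))
    ∧
    ((∀ σ : Equiv.Perm (Fin n), netP C (permVec σ) = fun k : Fin n => ((k : ℕ) : ℝ) + 1)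
      ↔ (∀ J : Finset (Fin n),
          netP C (chi J) = fun k : Fin n => if n - J.card ≤ (k : ℕ) then (1 : ℝ) else 0)) := by
  have hperm := monotone_netP_iff_permVec hn C
  refine ⟨⟨fun h => hperm.mp fun x => (h x).1, fun h x =>
    ⟨hperm.mpr h x, exists_perm_netP_eq C x⟩⟩, hperm.symm.trans (monotone_netP_iff_chi C)⟩
end
end

section
/- Let n ≥ 1 and let C = ((i_0, j_0), …, (i_{q−1}, j_{q−1})) be a sequence of coordinate pairs in [n]² with i_l < j_l, and let σ⁻_C := σ⁻_{i_{q−1},j_{q−1}} ∘ ⋯ ∘ σ⁻_{i_0,j_0} be the corresponding composition of conditional reflections onto the halfspaces {x_i ≥ x_j}. Then the following are equivalent: (i) for every x ∈ ℝⁿ, σ⁻_C(x) is the nonincreasing rearrangement of x; (ii) for every permutation σ of [n], σ⁻_C(x_σ) = (n, n−1, …, 1); (iii) for every J ⊆ [n], σ⁻_C(χ_J) = χ_{{1, 2, …, |J|}}. -/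
noncomputable section

/-- Conditional reflection `σ⁻_{i,j}`: replaces `(x i, x j)` by `(max, min)`. -/
def sigM {n : ℕ} (i j : Fin n) (x : Fin n → ℝ) : Fin n → ℝ :=
  fun k => if k = i then max (x i) (x j) else if k = j then min (x i) (x j) else x k

/-- `σ⁻_C = σ⁻_{i_{q-1},j_{q-1}} ∘ ⋯ ∘ σ⁻_{i_0,j_0}`. -/
def netM {n : ℕ} (C : List (Fin n × Fin n)) (x : Fin n → ℝ) : Fin n → ℝ :=
  C.foldl (fun y p => sigM p.1 p.2 y) x

theorem sigM_of_ge {n : ℕ} {i j : Fin n} {x : Fin n → ℝ} (h : x j ≤ x i) :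
    sigM i j x = x := by
  funext k
  unfold sigM
  split_ifs with h1 h2
  · rw [h1, max_eq_left h]
  · rw [h2, min_eq_right h]
  · rfl

theorem sigM_of_le {n : ℕ} {i j : Fin n} {x : Fin n → ℝ} (h : x i ≤ x j) :
    sigM i j x = x ∘ Equiv.swap i j := by
  funext k
  simp only [sigM, Function.comp_apply, Equiv.swap_apply_def]
  split_ifs
  · exact max_eq_right h
  · exact min_eq_left h
  · rfl

/-- If the order of the coordinates of `y` refines that of `x`, a network permutes the coordinates
of `x` and `y` in the same way. -/
theorem exists_perm_netM_eq_comp {n : ℕ} (C : List (Fin n × Fin n)) (x y : Fin n → ℝ)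
    (h : ∀ a b, y a ≤ y b → x a ≤ x b) :
    ∃ π : Equiv.Perm (Fin n), netM C x = x ∘ π ∧ netM C y = y ∘ π := by
  induction C generalizing x y with
  | nil => exact ⟨1, rfl, rfl⟩
  | cons p C ih =>
    change ∃ π : Equiv.Perm (Fin n), netM C (sigM p.1 p.2 x) = x ∘ π ∧
      netM C (sigM p.1 p.2 y) = y ∘ π
    rcases le_total (y p.2) (y p.1) with hy | hy
    · rw [sigM_of_ge hy, sigM_of_ge (h _ _ hy)]
      exact ih x y h
    · rw [sigM_of_le hy, sigM_of_le (h _ _ hy)]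
      obtain ⟨π, h1, h2⟩ := ih (x ∘ Equiv.swap p.1 p.2) (y ∘ Equiv.swap p.1 p.2)
        fun a b => h _ _
      exact ⟨Equiv.swap p.1 p.2 * π, h1, h2⟩

theorem permVec_le_permVec {n : ℕ} (σ : Equiv.Perm (Fin n)) (a b : Fin n) :
    permVec σ a ≤ permVec σ b ↔ σ a ≤ σ b := by
  simp [permVec]

theorem permVec_eq_of_antitone {n : ℕ} {σ : Equiv.Perm (Fin n)} (h : Antitone (permVec σ)) :
    permVec σ = fun k : Fin n => (n : ℝ) - (k : ℕ) := by
  have hanti : Antitone σ := fun a b hab => (permVec_le_permVec σ b a).1 (h hab)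
  have hs : StrictMono (σ ∘ Fin.rev) :=
    (hanti.strictAnti_of_injective σ.injective).comp Fin.rev_strictAnti
  have hid : σ ∘ Fin.rev = id :=
    (hs.range_inj strictMono_id).1 (by
      rw [(σ.surjective.comp Fin.rev_surjective).range_eq, Set.range_id])
  funext k
  have hk : σ k = Fin.rev k := by simpa using congrFun hid (Fin.rev k)
  simp only [permVec, hk, Fin.val_rev]
  rw [Nat.cast_sub (by omega)]
  push_cast
  ring

theorem chi_eq_of_antitone {n : ℕ} {K : Finset (Fin n)} (h : Antitone (chi K)) :
    chi K = fun k : Fin n => if (k : ℕ) < K.card then (1 : ℝ) else 0 := by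
  have hlower : ∀ a b, a ≤ b → b ∈ K → a ∈ K := by
    intro a b hab hb
    by_contra ha
    have := h hab
    simp only [chi, if_pos hb, if_neg ha] at this
    linarith
  funext k
  have hiff : k ∈ K ↔ (k : ℕ) < K.card := by
    constructor
    · intro hk
      have := Finset.card_le_card (s := Finset.Iic k) (t := K)
        fun a ha => hlower a k (Finset.mem_Iic.1 ha) hk
      rw [Fin.card_Iic] at this
      omega
    · intro hlt
      by_contra hk
      have := Finset.card_le_card (s := K) (t := Finset.Iio k) fun a ha =>
        Finset.mem_Iio.2 (lt_of_not_ge fun hka => hk (hlower k a hka ha))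
      rw [Fin.card_Iio] at this
      omega
  simp only [chi, hiff]

theorem chi_comp_perm {n : ℕ} (J : Finset (Fin n)) (π : Equiv.Perm (Fin n)) :
    chi J ∘ π = chi (J.map π.symm.toEmbedding) := by
  funext k
  simp [chi, Finset.mem_map_equiv]

theorem netM_sorts_iff_permVec {n : ℕ} (C : List (Fin n × Fin n)) :
    (∀ x : Fin n → ℝ, Antitone (netM C x) ∧ ∃ π : Equiv.Perm (Fin n), netM C x = x ∘ π)
      ↔ (∀ σ : Equiv.Perm (Fin n),
          netM C (permVec σ) = fun k : Fin n => (n : ℝ) - (k : ℕ)) := by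
  constructor
  · intro h σ
    obtain ⟨hanti, π, hπ⟩ := h (permVec σ)
    rw [hπ] at hanti ⊢
    exact permVec_eq_of_antitone (σ := σ * π) hanti
  · intro h x
    obtain ⟨π, hx, hy⟩ := exists_perm_netM_eq_comp C x (permVec (Tuple.sort x)⁻¹) (by
      intro a b hab
      simpa using Tuple.monotone_sort x ((permVec_le_permVec _ a b).1 hab))
    refine ⟨fun a b hab => ?_, π, hx⟩
    rw [hx]
    have hle : permVec (Tuple.sort x)⁻¹ (π b) ≤ permVec (Tuple.sort x)⁻¹ (π a) := by
      have hval := hy.symm.trans (h _)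
      have ha := congrFun hval a
      have hb := congrFun hval b
      simp only [Function.comp_apply] at ha hb
      rw [ha, hb]
      have : ((a : ℕ) : ℝ) ≤ (b : ℕ) := by exact_mod_cast hab
      linarith
    simpa using Tuple.monotone_sort x ((permVec_le_permVec _ _ _).1 hle)

theorem netM_sorts_iff_chi {n : ℕ} (C : List (Fin n × Fin n)) :
    (∀ x : Fin n → ℝ, Antitone (netM C x) ∧ ∃ π : Equiv.Perm (Fin n), netM C x = x ∘ π)
      ↔ (∀ J : Finset (Fin n),
          netM C (chi J) = fun k : Fin n => if (k : ℕ) < J.card then (1 : ℝ) else 0) := by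
  constructor
  · intro h J
    obtain ⟨hanti, π, hπ⟩ := h (chi J)
    rw [hπ, chi_comp_perm] at hanti ⊢
    simpa using chi_eq_of_antitone hanti
  · intro h x
    refine ⟨fun a b hab => ?_, ?_⟩
    · obtain ⟨J, hJ⟩ : ∃ J : Finset (Fin n), ∀ k, k ∈ J ↔ netM C x b ≤ x k :=
        ⟨Finset.univ.filter fun k => netM C x b ≤ x k, by simp⟩
      obtain ⟨π, hc, hx⟩ := exists_perm_netM_eq_comp C (chi J) x (by
        intro c d hcd
        simp only [chi, hJ]
        split_ifs with h1 h2 <;> first | exact absurd (h1.trans hcd) h2 | norm_num)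
      have hb : π b ∈ J := by rw [hJ, hx, Function.comp_apply]
      have hval := hc.symm.trans (h J)
      have hbJ : (b : ℕ) < J.card := by
        by_contra hlt
        simpa [chi, hb, hlt] using congrFun hval b
      have haJ : (a : ℕ) < J.card := lt_of_le_of_lt hab hbJ
      have ha : π a ∈ J := by
        by_contra hna
        simpa [chi, hna, haJ] using congrFun hval a
      rw [congrFun hx a]
      exact (hJ _).1 ha
    · obtain ⟨π, hπ, -⟩ := exists_perm_netM_eq_comp C x x fun _ _ => id
      exact ⟨π, hπ⟩

/-- Equivalence of the three definitions of a *reverse* sorting network: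
(i) every vector is mapped to its nonincreasing rearrangement;
(ii) every permutation vector is mapped to `(n,…,2,1)`;
(iii) every characteristic vector `χ_J` is mapped to `χ_{{1,…,|J|}}`. -/
theorem stmt4 (n : ℕ) (hn : 1 ≤ n) (C : List (Fin n × Fin n))
    (hC : ∀ p ∈ C, p.1 < p.2) :
    ((∀ x : Fin n → ℝ, Antitone (netM C x) ∧
        ∃ π : Equiv.Perm (Fin n), netM C x = x ∘ π)
      ↔ (∀ σ : Equiv.Perm (Fin n), netM C (permVec σ) = fun k : Fin n => (n : ℝ) - (k : ℕ)))
    ∧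
    ((∀ σ : Equiv.Perm (Fin n), netM C (permVec σ) = fun k : Fin n => (n : ℝ) - (k : ℕ))
      ↔ (∀ J : Finset (Fin n),
          netM C (chi J) = fun k : Fin n => if (k : ℕ) < J.card then (1 : ℝ) else 0)) := by
  exact ⟨netM_sorts_iff_permVec C,
    (netM_sorts_iff_permVec C).symm.trans (netM_sorts_iff_chi C)⟩
end
end

section
/- Let n ≥ 1 and let C = ((i_0, j_0), …, (i_{q−1}, j_{q−1})), with i_l < j_l, be a sorting network for ℝⁿ (i.e. the composition σ⁺_C of the conditional reflections σ⁺_{i_l,j_l} maps every x ∈ ℝⁿ to its nondecreasing rearrangement). For a permutation σ of [n], define the sequence σ^(0) := σ and x_{σ^(l+1)} := σ⁺_{i_l,j_l}(x_{σ^(l)}); for J ⊆ [n], define J_0 := J and χ_{J_{l+1}} := σ⁻_{i_l,j_l}(χ_{J_l}). Then for every permutation σ of [n] and every nonempty proper subset J ⊆ [n]: Σ_{j ∈ J} σ(j) − |J|(|J|+1)/2 = Σ_{l=0}^{q−1} [ 𝟙[j_l ∈ J_l and i_l ∉ J_l] · (σ^(l)(j_l) − σ^(l)(i_l))₊ + 𝟙[i_l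 ∈ J_l and j_l ∉ J_l] · (σ^(l)(i_l) − σ^(l)(j_l))₊ ], where a₊ := max{0, a}. -/
noncomputable section

lemma sigM_mem_zero_one {n : ℕ} (i j : Fin n) {w : Fin n → ℝ}
    (hw : ∀ k, w k = 0 ∨ w k = 1) (k : Fin n) : sigM i j w k = 0 ∨ sigM i j w k = 1 := by
  unfold sigM
  rcases hw i with h | h <;> rcases hw j with h' | h' <;> split_ifs <;> simp [h, h', hw k]

lemma sigM_eq_neg_sigP_neg {n : ℕ} (i j : Fin n) (w : Fin n → ℝ) :
    sigM i j w = -sigP i j (-w) := by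
  funext k
  simp only [sigM, sigP, Pi.neg_apply]
  split_ifs
  · rw [min_neg_neg, neg_neg]
  · rw [max_neg_neg, neg_neg]
  · rw [neg_neg]

lemma netM_eq_neg_netP_neg {n : ℕ} (C : List (Fin n × Fin n)) (w : Fin n → ℝ) :
    netM C w = -netP C (-w) := by
  induction C generalizing w with
  | nil => simp [netM, netP]
  | cons p C ih =>
    change netM C (sigM p.1 p.2 w) = -netP C (sigP p.1 p.2 (-w))
    rw [ih, sigM_eq_neg_sigP_neg, neg_neg]

/-- The contribution of the comparator `(i, j)` to the slack. -/
def comparatorSlack {n : ℕ} (w y : Fin n → ℝ) (i j : Fin n) : ℝ :=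
  (if w j = 1 ∧ w i = 0 then (1 : ℝ) else 0) * max 0 (y j - y i)
    + (if w i = 1 ∧ w j = 0 then (1 : ℝ) else 0) * max 0 (y i - y j)

lemma sum_mul_sub_sum_sigM_mul_sigP {n : ℕ} {i j : Fin n} (hij : i ≠ j) {w : Fin n → ℝ}
    (hw : ∀ k, w k = 0 ∨ w k = 1) (y : Fin n → ℝ) :
    ∑ k, w k * y k - ∑ k, sigM i j w k * sigP i j y k = comparatorSlack w y i j := by
  rw [← Finset.sum_sub_distrib, Fintype.sum_eq_add i j hij]
  · simp only [sigM, sigP, comparatorSlack, if_pos, if_neg hij.symm]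
    rcases hw i with h | h <;> rcases hw j with h' | h' <;>
      rcases le_total (y i) (y j) with h'' | h'' <;> simp [h, h', h'', neg_add_eq_sub]
  · rintro k ⟨hi, hj⟩
    simp [sigM, sigP, hi, hj]

lemma sum_mul_sub_sum_netM_mul_netP {n : ℕ} (C : List (Fin n × Fin n))
    (hC : ∀ p ∈ C, p.1 < p.2) {w : Fin n → ℝ} (hw : ∀ k, w k = 0 ∨ w k = 1)
    (y : Fin n → ℝ) :
    ∑ k, w k * y k - ∑ k, netM C w k * netP C y k
      = ∑ l : Fin C.length, comparatorSlack (netM (C.take l.1) w) (netP (C.take l.1) y)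
          (C.get l).1 (C.get l).2 := by
  induction C generalizing w y with
  | nil => simp [netM, netP]
  | cons p C ih =>
    have h₁ := sum_mul_sub_sum_sigM_mul_sigP (hC p (by simp)).ne hw y
    have h₂ := ih (fun q hq => hC q (by simp [hq])) (sigM_mem_zero_one p.1 p.2 hw)
      (sigP p.1 p.2 y)
    have h₃ := Fin.sum_univ_succ (n := C.length) fun l : Fin (C.length + 1) =>
      comparatorSlack (netM ((p :: C).take l.1) w) (netP ((p :: C).take l.1) y)
        ((p :: C).get l).1 ((p :: C).get l).2
    refine Eq.trans ?_ h₃.symm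
    change _ = comparatorSlack w y p.1 p.2 + ∑ l : Fin C.length,
      comparatorSlack (netM (C.take l.1) (sigM p.1 p.2 w))
        (netP (C.take l.1) (sigP p.1 p.2 y)) (C.get l).1 (C.get l).2
    rw [← h₁, ← h₂]
    change _ - ∑ k, netM C (sigM p.1 p.2 w) k * netP C (sigP p.1 p.2 y) k = _
    ring

lemma Finset.eq_range_card_of_isLowerSet {s : Finset ℕ} (hs : IsLowerSet (s : Set ℕ)) :
    s = Finset.range s.card := by
  refine Finset.eq_of_subset_of_card_le (fun k hk => ?_) (by simp)
  have h : Finset.range (k + 1) ⊆ s := fun m hm =>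
    hs (Nat.lt_succ_iff.mp (Finset.mem_range.mp hm)) hk
  simpa using Finset.card_le_card h

lemma sum_val_add_one_of_isLowerSet {n : ℕ} {K : Finset (Fin n)}
    (hK : IsLowerSet (K : Set (Fin n))) :
    ∑ k ∈ K, (((k : ℕ) : ℝ) + 1) = (K.card : ℝ) * ((K.card : ℝ) + 1) / 2 := by
  have hs : IsLowerSet ((K.map Fin.valEmbedding : Finset ℕ) : Set ℕ) := by
    intro a b hba ha
    simp only [Finset.coe_map, Set.mem_image, Finset.mem_coe] at ha ⊢
    obtain ⟨k, hk, rfl⟩ := ha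
    exact ⟨⟨b, hba.trans_lt k.2⟩, hK (Fin.le_def.mpr hba) hk, rfl⟩
  have hr := Finset.eq_range_card_of_isLowerSet hs
  rw [Finset.card_map] at hr
  have hsum := Finset.sum_map K Fin.valEmbedding fun m : ℕ => (m : ℝ) + 1
  rw [hr] at hsum
  refine hsum.symm.trans ?_
  induction K.card with
  | zero => simp
  | succ m ih => rw [Finset.sum_range_succ, ih]; push_cast; ring

lemma permVec_eq_of_monotone {n : ℕ} {τ : Equiv.Perm (Fin n)} (h : Monotone (permVec τ)) :
    permVec τ = fun k : Fin n => ((k : ℕ) : ℝ) + 1 := by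
  have hm : Monotone τ := fun a b hab => by
    have := h hab
    simpa [permVec] using this
  have hτ : (τ : Fin n → Fin n) = id :=
    (hm.strictMono_of_injective τ.injective).range_inj strictMono_id |>.mp (by simp)
  funext k
  simp [permVec, hτ]

/-- The telescoping formula for the slack of the permutahedron along a sorting
network: `x_{σ^{(l)}} = netP (C.take l) (permVec σ)` and
`χ_{J_l} = netM (C.take l) (chi J)`, so membership `m ∈ J_l` reads
`netM (C.take l) (chi J) m = 1`. -/
theorem stmt9 (n : ℕ) (hn : 1 ≤ n) (C : List (Fin n × Fin n))
    (hC : ∀ p ∈ C, p.1 < p.2)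
    (hsort : ∀ x : Fin n → ℝ, Monotone (netP C x) ∧
      ∃ π : Equiv.Perm (Fin n), netP C x = x ∘ π)
    (σ : Equiv.Perm (Fin n)) (J : Finset (Fin n))
    (hJ : J.Nonempty) (hJu : J ≠ Finset.univ) :
    (∑ j ∈ J, (((σ j : ℕ) : ℝ) + 1)) - (J.card : ℝ) * ((J.card : ℝ) + 1) / 2
      = ∑ l : Fin C.length,
          ((if netM (C.take l.1) (chi J) (C.get l).2 = 1
              ∧ netM (C.take l.1) (chi J) (C.get l).1 = 0 then (1 : ℝ) else 0)
            * max 0 (netP (C.take l.1) (permVec σ) (C.get l).2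
                - netP (C.take l.1) (permVec σ) (C.get l).1)
          + (if netM (C.take l.1) (chi J) (C.get l).1 = 1
              ∧ netM (C.take l.1) (chi J) (C.get l).2 = 0 then (1 : ℝ) else 0)
            * max 0 (netP (C.take l.1) (permVec σ) (C.get l).1
                - netP (C.take l.1) (permVec σ) (C.get l).2)) := by
  have hw : ∀ k, chi J k = 0 ∨ chi J k = 1 := fun k => by
    unfold chi; split_ifs <;> simp
  refine Eq.trans ?_ (sum_mul_sub_sum_netM_mul_netP C hC hw (permVec σ))
  have hfirst : ∑ k, chi J k * permVec σ k = ∑ j ∈ J, (((σ j : ℕ) : ℝ) + 1) := by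
    simp [chi, permVec]
  obtain ⟨hmono, π, hπ⟩ := hsort (permVec σ)
  have hP : netP C (permVec σ) = fun k : Fin n => ((k : ℕ) : ℝ) + 1 := by
    have h : netP C (permVec σ) = permVec (π.trans σ) := hπ
    rw [h] at hmono ⊢
    exact permVec_eq_of_monotone hmono
  obtain ⟨hanti, ρ, hρ⟩ := hsort (-chi J)
  set K := J.map ρ.symm.toEmbedding with hK
  have hM : netM C (chi J) = chi K := by
    funext k
    rw [netM_eq_neg_netP_neg, hρ]
    simp [chi, hK]
  have hlow : IsLowerSet (K : Set (Fin n)) := by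
    intro a b hba ha
    have h : chi K a ≤ chi K b := by
      rw [← hM, netM_eq_neg_netP_neg]
      exact neg_le_neg (hanti hba)
    by_contra hb
    rw [Finset.mem_coe] at ha hb
    simp only [chi, if_pos ha, if_neg hb] at h
    linarith
  have hcard : K.card = J.card := Finset.card_map _
  have hlast : ∑ k, netM C (chi J) k * netP C (permVec σ) k
      = (J.card : ℝ) * ((J.card : ℝ) + 1) / 2 := by
    rw [hM, hP, ← hcard, ← sum_val_add_one_of_isLowerSet hlow]
    simp [chi]
  rw [hfirst, hlast]
end
end

section
/- Let n ≥ 1. The image of the set of doubly stochastic n×n matrices (matrices with nonnegative entries all of whose row sums and column sums equal 1) under the linear map π : M ↦ M · (1, 2, …, n)ᵀ equals the permutahedron Perm(n), i.e. the convex hull in ℝⁿ of the vectors x_σ = (σ(1), …, σ(n)) over all permutations σ of [n]. -/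
noncomputable section

open scoped Matrix in
/-- Multiplying the doubly stochastic matrices by a fixed vector `w` yields the convex hull of the
rearrangements of `w`. -/
theorem image_mulVec_doublyStochastic {ι : Type*} [Fintype ι] [DecidableEq ι] (w : ι → ℝ) :
    (fun M : Matrix ι ι ℝ => M *ᵥ w) '' (doublyStochastic ℝ ι : Set (Matrix ι ι ℝ))
      = convexHull ℝ (Set.range fun σ : Equiv.Perm ι => w ∘ σ) := by
  have himage := ((Matrix.mulVecBilin ℝ ℝ (m := ι) (n := ι)).flip w).image_convexHull
    {σ.permMatrix ℝ | σ : Equiv.Perm ι}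
  rw [← doublyStochastic_eq_convexHull_permMatrix] at himage
  refine himage.trans (congrArg _ ?_)
  ext v
  simp [Matrix.permMatrix_mulVec]

/-- The image of the Birkhoff polytope (doubly stochastic matrices) under
`M ↦ M·(1,2,…,n)ᵀ` is the permutahedron `Perm(n)`. -/
theorem stmt12 (n : ℕ) (hn : 1 ≤ n) :
    {v : Fin n → ℝ | ∃ M : Matrix (Fin n) (Fin n) ℝ,
        (∀ i j, 0 ≤ M i j) ∧
        (∀ i, ∑ j, M i j = 1) ∧
        (∀ j, ∑ i, M i j = 1) ∧
        v = fun i => ∑ j : Fin n, (((j : ℕ) : ℝ) + 1) * M i j}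
      = convexHull ℝ {x : Fin n → ℝ | ∃ σ : Equiv.Perm (Fin n), x = permVec σ} := by
  have hrange : {x : Fin n → ℝ | ∃ σ : Equiv.Perm (Fin n), x = permVec σ}
      = Set.range fun σ : Equiv.Perm (Fin n) => (fun j : Fin n => ((j : ℕ) : ℝ) + 1) ∘ σ := by
    ext x
    exact exists_congr fun σ => eq_comm
  rw [hrange, ← image_mulVec_doublyStochastic]
  ext v
  simp only [Set.mem_ofPred_eq, Set.mem_image, SetLike.mem_coe, mem_doublyStochastic_iff_sum,
    and_assoc]
  refine exists_congr fun M => and_congr_right' (and_congr_right' (and_congr_right' ?_))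
  rw [eq_comm]
  simp only [Matrix.mulVec_eq_sum, funext_iff, Finset.sum_apply, Pi.smul_apply,
    Matrix.transpose_apply, MulOpposite.smul_eq_mul_unop, MulOpposite.unop_op, mul_comm]
end
end

section
/- Let n ≥ 3 and consider the complete graph K_n on vertex set [n]. Let S be the nonnegative matrix whose rows are indexed by the subsets U ⊆ [n] with 2 ≤ |U| ≤ n−1, whose columns are indexed by the spanning trees T of K_n, and whose entries are S_{U,T} = |U| − 1 − |T ∩ E(U)|, where T ∩ E(U) is the set of edges of T with both endpoints in U. Then the nonnegative rank of S is at most n(n−1)(n−2). -/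
noncomputable section

/-- In the tree `T` rooted at `r`, the vertex `w` is the parent of `v`. -/
def SimpleGraph.IsParent {V : Type*} (T : SimpleGraph V) (r v w : V) : Prop :=
  T.Adj v w ∧ T.dist r v = T.dist r w + 1

lemma SimpleGraph.IsTree.existsUnique_isParent {V : Type*} {T : SimpleGraph V} (hT : T.IsTree)
    {r v : V} (hv : v ≠ r) : ∃! w, T.IsParent r v w := by
  obtain ⟨p, -, hlen⟩ := (hT.connected r v).exists_path_of_dist
  have hnil : ¬ p.Nil := fun h => hv h.eq.symm
  refine existsUnique_of_exists_of_unique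
    ⟨p.penultimate, (p.adj_penultimate hnil).symm, ?_⟩ ?_
  · have hle := SimpleGraph.dist_le p.dropLast
    have hlen' := SimpleGraph.Walk.length_dropLast_add_one hnil
    have := hT.dist_eq_dist_add_one_of_adj r (p.adj_penultimate hnil)
    omega
  · have key (w : V) (hw : T.IsParent r v w) :
        ∃ q : T.Walk r v, q.IsPath ∧ q.penultimate = w := by
      obtain ⟨q, -, hq⟩ := (hT.connected r w).exists_path_of_dist
      refine ⟨q.concat hw.1.symm, ?_, by simp⟩
      apply SimpleGraph.Walk.isPath_of_length_eq_dist
      rw [SimpleGraph.Walk.length_concat, hq, hw.2]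
    intro w w' hw hw'
    obtain ⟨q, hq, rfl⟩ := key w hw
    obtain ⟨q', hq', rfl⟩ := key w' hw'
    rw [(hT.existsUnique_path r v).unique hq hq']

open Classical in
/-- Assigning to every non-root vertex of `U` the edge to its parent is a bijection from those
vertices whose parent lies in `U` onto the tree edges inside `U`. -/
lemma SimpleGraph.IsTree.ncard_edges_within {V : Type*} {T : SimpleGraph V} (hT : T.IsTree)
    (U : Finset V) {r : V} (parent : V → V)
    (hparent : ∀ v, v ≠ r → T.IsParent r v (parent v)) (hr : r ∈ U) :
    {e ∈ T.edgeSet | ∀ v ∈ e, v ∈ (U : Set V)}.ncard =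
      {v ∈ U.erase r | parent v ∈ U}.card := by
  rw [← Set.ncard_coe_finset]
  symm
  refine Set.ncard_congr (fun v _ => s(v, parent v)) ?_ ?_ ?_
  · intro v hv
    simp only [Finset.coe_filter, Finset.mem_erase, Set.mem_ofPred_eq] at hv
    exact ⟨(hparent v hv.1.1).1, by simp [hv.1.2, hv.2]⟩
  · intro v v' hv hv' h
    simp only [Finset.coe_filter, Finset.mem_erase, Set.mem_ofPred_eq] at hv hv'
    have h₁ := (hparent v hv.1.1).2
    have h₂ := (hparent v' hv'.1.1).2
    rcases Sym2.eq_iff.1 h with ⟨h, -⟩ | ⟨h, h'⟩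
    · exact h
    · rw [h'] at h₁
      rw [← h] at h₂
      omega
  · have key (v w : V) (hvw : T.Adj v w) (hv : v ∈ U) (hw : w ∈ U)
        (hd : T.dist r v = T.dist r w + 1) :
        ∃ a, ∃ _ : a ∈ (({v ∈ U.erase r | parent v ∈ U} : Finset V) : Set V),
          s(a, parent a) = s(v, w) := by
      have hvr : v ≠ r := by
        rintro rfl
        simp at hd
      have hpw : parent v = w :=
        (hT.existsUnique_isParent hvr).unique (hparent v hvr) ⟨hvw, hd⟩
      exact ⟨v, by simp [hvr, hv, hpw, hw], by rw [hpw]⟩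
    intro e he
    induction e with | _ v w
    obtain ⟨hvw, hU⟩ := he
    have hv : v ∈ U := hU v (by simp)
    have hw : w ∈ U := hU w (by simp)
    rcases hT.dist_eq_dist_add_one_of_adj r hvw with hd | hd
    · exact key v w hvw hv hw hd
    · rw [Sym2.eq_swap]
      exact key w v hvw.symm hw hv hd

open Classical in
/-- The spanning tree slack of `U` counts the vertices of `U` whose parent leaves `U`, where the
tree is rooted at `r ∈ U`; this count is taken over ordered triples of distinct vertices. -/
lemma SimpleGraph.IsTree.slack_eq_card {V : Type*} [Fintype V] {T : SimpleGraph V}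
    (hT : T.IsTree) (U : Finset V) {r : V} (hr : r ∈ U) :
    (U.card : ℝ) - 1 - ({e ∈ T.edgeSet | ∀ v ∈ e, v ∈ (U : Set V)}.ncard : ℝ) =
      ({f : Fin 3 ↪ V | (f 0 = r ∧ f 1 ∈ U ∧ f 2 ∉ U) ∧
        T.IsParent (f 0) (f 1) (f 2)} : Finset (Fin 3 ↪ V)).card := by
  have hex (v : V) : ∃ w, v ≠ r → T.IsParent r v w := by
    by_cases h : v = r
    · exact ⟨r, fun h' => absurd h h'⟩
    · exact (hT.existsUnique_isParent h).exists.imp fun _ hw _ => hw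
  choose parent hparent using hex
  have hbij : {v ∈ U.erase r | parent v ∉ U}.card =
      ({f : Fin 3 ↪ V | (f 0 = r ∧ f 1 ∈ U ∧ f 2 ∉ U) ∧
        T.IsParent (f 0) (f 1) (f 2)} : Finset (Fin 3 ↪ V)).card := by
    symm
    refine Finset.card_bij (fun f _ => f 1) ?_ ?_ ?_
    · intro f hf
      simp only [Finset.mem_filter, Finset.mem_univ, true_and] at hf
      obtain ⟨⟨rfl, h₁, h₂⟩, hp⟩ := hf
      have hne : f 1 ≠ f 0 := f.injective.ne (by decide)
      have := (hT.existsUnique_isParent hne).unique (hparent _ hne) hp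
      simp [hne, h₁, this, h₂]
    · intro f hf g hg hfg
      simp only [Finset.mem_filter, Finset.mem_univ, true_and] at hf hg
      obtain ⟨⟨hf₀, -, -⟩, hpf⟩ := hf
      obtain ⟨⟨hg₀, -, -⟩, hpg⟩ := hg
      have hne : f 1 ≠ f 0 := f.injective.ne (by decide)
      rw [hg₀, ← hf₀, ← hfg] at hpg
      have := (hT.existsUnique_isParent hne).unique hpf hpg
      ext i
      fin_cases i
      · exact hf₀.trans hg₀.symm
      · exact hfg
      · exact this
    · intro v hv
      simp only [Finset.mem_filter, Finset.mem_erase] at hv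
      obtain ⟨⟨hvr, hvU⟩, hpU⟩ := hv
      have h₁ : parent v ≠ r := fun h => hpU (h ▸ hr)
      have h₂ : parent v ≠ v := fun h => hpU (by rwa [h])
      have hinj : Function.Injective ![r, v, parent v] := by
        intro i j h
        fin_cases i <;> fin_cases j <;> simp_all [eq_comm]
      exact ⟨⟨_, hinj⟩, by simp [hvU, hpU, hparent v hvr], rfl⟩
  rw [hT.ncard_edges_within U parent hparent hr, ← hbij]
  have hsplit := Finset.card_filter_add_card_filter_not (s := U.erase r) (fun v => parent v ∈ U)
  have hcard := Finset.card_erase_add_one hr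
  rw [← hcard, ← hsplit]
  push_cast
  ring

/-- The slack matrix of the spanning tree polytope of `K_n` — rows indexed by
subsets `U ⊆ [n]` with `2 ≤ |U| ≤ n−1`, columns by spanning trees `T` of `K_n`,
entries `|U| − 1 − |T ∩ E(U)|` — has nonnegative rank at most `n(n−1)(n−2)`. -/
theorem stmt14 (n : ℕ) (hn : 3 ≤ n) :
    ∃ (A : Finset (Fin n) → Fin (n * (n - 1) * (n - 2)) → ℝ)
      (B : Fin (n * (n - 1) * (n - 2)) → SimpleGraph (Fin n) → ℝ),
      (∀ U k, 0 ≤ A U k) ∧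
      (∀ k T, T.IsTree → 0 ≤ B k T) ∧
      (∀ U : Finset (Fin n), 2 ≤ U.card → U.card ≤ n - 1 →
        ∀ T : SimpleGraph (Fin n), T.IsTree →
          (U.card : ℝ) - 1 - ({e ∈ T.edgeSet | ∀ v ∈ e, v ∈ (U : Set (Fin n))}.ncard : ℝ)
            = ∑ k, A U k * B k T) := by
  classical
  have hcard : Fintype.card (Fin 3 ↪ Fin n) = n * (n - 1) * (n - 2) := by
    simp only [Fintype.card_embedding_eq, Fintype.card_fin, Nat.descFactorial, Nat.sub_zero]
    ring_nf
  let φ := (Fintype.equivFinOfCardEq hcard).symm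
  have hroot (U : Finset (Fin n)) : ∃ r, U.Nonempty → r ∈ U := by
    by_cases h : U.Nonempty
    · exact h.imp fun _ hr _ => hr
    · exact ⟨⟨0, by omega⟩, fun h' => absurd h' h⟩
  choose root hroot using hroot
  refine ⟨fun U k => if φ k 0 = root U ∧ φ k 1 ∈ U ∧ φ k 2 ∉ U then 1 else 0,
    fun k T => if T.IsParent (φ k 0) (φ k 1) (φ k 2) then 1 else 0, ?_, ?_, ?_⟩
  · intro U k
    positivity
  · intro k T _
    positivity
  · intro U hU _ T hT
    rw [hT.slack_eq_card U (hroot U (Finset.card_pos.1 (by omega)))]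
    rw [Equiv.sum_comp φ (fun f => (if f 0 = root U ∧ f 1 ∈ U ∧ f 2 ∉ U then (1 : ℝ) else 0) *
      if T.IsParent (f 0) (f 1) (f 2) then 1 else 0)]
    simp only [mul_ite, mul_one, mul_zero, ← ite_and, Finset.sum_boole, and_comm]
    congr!
end
end

section
/- Let n ≥ 3 and consider the complete graph K_n on vertex set [n]. Let S be the nonnegative matrix whose rows are indexed by the disjoint union of: the edges e of K_n, the vertices v ∈ [n], and the subsets U ⊆ [n] with |U| odd and |U| ≥ 3; whose columns are indexed by the matchings M of K_n; and whose entries are S_{e,M} = 𝟙[e ∈ M], S_{v,M} = 1 − |{e ∈ M : v ∈ e}|, and S_{U,M} = (|U|−1)/2 − |{e ∈ M : e ⊆ U}|. Then the nonnegative rank of S is at most n³ · ln(n) · 1.5ⁿ. -/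
noncomputable section

namespace EdmondsSlack

variable {V : Type*}

/-- A set of pairwise disjoint two-element subsets. -/
def IsMatching (M : Finset (Finset V)) : Prop :=
  (∀ e ∈ M, e.card = 2) ∧ ∀ e ∈ M, ∀ f ∈ M, e ≠ f → Disjoint e f

/-- `X` contains exactly one endpoint of every edge of `M`. -/
def Splits [DecidableEq V] (X : Finset V) (M : Finset (Finset V)) : Prop :=
  ∀ e ∈ M, (e ∩ X).card = 1

instance [DecidableEq V] (X : Finset V) (M : Finset (Finset V)) : Decidable (Splits X M) :=
  inferInstanceAs (Decidable (∀ e ∈ M, (e ∩ X).card = 1))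

theorem IsMatching.subset {M N : Finset (Finset V)} (hN : IsMatching N) (h : M ⊆ N) :
    IsMatching M :=
  ⟨fun e he => hN.1 e (h he), fun e he f hf => hN.2 e (h he) f (h hf)⟩

theorem IsMatching.card_filter_mem_le_one [DecidableEq V] {M : Finset (Finset V)}
    (hM : IsMatching M) (v : V) : (M.filter (fun e => v ∈ e)).card ≤ 1 := by
  rw [Finset.card_le_one]
  intro e he f hf
  rw [Finset.mem_filter] at he hf
  by_contra hne
  exact Finset.disjoint_left.mp (hM.2 e he.1 f hf.1 hne) he.2 hf.2

theorem IsMatching.two_mul_card_le [Fintype V] [DecidableEq V] {M : Finset (Finset V)}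
    (hM : IsMatching M) : 2 * M.card ≤ Fintype.card V := by
  have h : (M.biUnion id).card = ∑ e ∈ M, e.card :=
    Finset.card_biUnion fun e he f hf hne => hM.2 e he f hf hne
  rw [Finset.sum_congr rfl hM.1, Finset.sum_const, smul_eq_mul] at h
  have := Finset.card_le_univ (M.biUnion id)
  omega

section Counting

variable [Fintype V] [DecidableEq V]

theorem IsMatching.two_pow_le_card_splits {M : Finset (Finset V)} (hM : IsMatching M) :
    2 ^ Fintype.card V ≤ 2 ^ M.card * (Finset.univ.filter fun X => Splits X M).card := by
  induction M using Finset.induction_on with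
  | empty => simp [Splits]
  | insert e M heM ih =>
    have ih := ih (hM.subset (Finset.subset_insert e M))
    obtain ⟨u, v, huv, rfl⟩ := Finset.card_eq_two.mp (hM.1 e (Finset.mem_insert_self e M))
    have hv : ∀ f ∈ M, v ∉ f := fun f hf hvf =>
      Finset.disjoint_left.mp
        (hM.2 _ (Finset.mem_insert_self _ M) f (Finset.mem_insert_of_mem hf)
          fun h => heM (h ▸ hf)) (by simp) hvf
    have hle : ((Finset.univ.filter fun X => Splits X M).filter
          fun X => ¬ ({u, v} ∩ X : Finset V).card = 1).card ≤
        (Finset.univ.filter fun X => Splits X (insert {u, v} M)).card := by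
      refine Finset.card_le_card_of_injOn (fun X => symmDiff X {v}) ?_ ?_
      · intro X hX
        simp only [Finset.coe_filter, Finset.mem_filter, Finset.mem_univ, true_and,
          Set.mem_ofPred_eq] at hX ⊢
        intro f hf
        rcases Finset.mem_insert.mp hf with rfl | hf
        · have h := hX.2
          by_cases h1 : u ∈ X <;> by_cases h2 : v ∈ X
          · rw [Finset.card_eq_one]
            refine ⟨u, ?_⟩
            ext w
            simp only [Finset.mem_inter, Finset.mem_insert, Finset.mem_singleton,
              Finset.mem_symmDiff]
            grind
          · refine absurd ?_ h
            rw [Finset.card_eq_one]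
            refine ⟨u, ?_⟩
            ext w
            simp only [Finset.mem_inter, Finset.mem_insert, Finset.mem_singleton]
            grind
          · refine absurd ?_ h
            rw [Finset.card_eq_one]
            refine ⟨v, ?_⟩
            ext w
            simp only [Finset.mem_inter, Finset.mem_insert, Finset.mem_singleton]
            grind
          · rw [Finset.card_eq_one]
            refine ⟨v, ?_⟩
            ext w
            simp only [Finset.mem_inter, Finset.mem_insert, Finset.mem_singleton,
              Finset.mem_symmDiff]
            grind
        · rw [← hX.1 f hf]
          congr 1
          ext w
          have := hv f hf
          simp only [Finset.mem_inter, Finset.mem_singleton, Finset.mem_symmDiff]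
          grind
      · intro X _ Y _ h
        exact symmDiff_left_injective _ h
    have heq : (Finset.univ.filter fun X => Splits X M).filter
          (fun X => ({u, v} ∩ X : Finset V).card = 1) =
        Finset.univ.filter fun X => Splits X (insert {u, v} M) := by
      ext X
      simp only [Finset.mem_filter, Finset.mem_univ, true_and]
      simp only [Splits, Finset.forall_mem_insert]
      tauto
    have hsum := Finset.card_filter_add_card_filter_not
      (s := Finset.univ.filter fun X => Splits X M)
      (fun X => ({u, v} ∩ X : Finset V).card = 1)
    rw [heq] at hsum
    rw [Finset.card_insert_of_notMem heM, pow_succ, mul_assoc]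
    exact ih.trans (Nat.mul_le_mul_left _ (by omega))

open Classical in
theorem card_isMatching_le :
    (Finset.univ.filter fun M : Finset (Finset V) => IsMatching M).card ≤
      Fintype.card V ^ Fintype.card V := by
  let g : (V → V) → Finset (Finset V) := fun f =>
    (Finset.univ.image fun u => ({u, f u} : Finset V)).filter fun e => e.card = 2
  have hsub : (Finset.univ.filter fun M : Finset (Finset V) => IsMatching M) ⊆
      Finset.univ.image g := by
    intro M hM
    have hM : IsMatching M := (Finset.mem_filter.mp hM).2
    have hmate : ∀ u, ∃ w, (({u, w} : Finset V) ∈ M) ∨ (w = u ∧ ∀ e ∈ M, u ∉ e) := by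
      intro u
      by_cases h : ∃ e ∈ M, u ∈ e
      · obtain ⟨e, he, hu⟩ := h
        obtain ⟨a, b, -, rfl⟩ := Finset.card_eq_two.mp (hM.1 e he)
        rcases Finset.mem_insert.mp hu with rfl | hu
        · exact ⟨b, Or.inl he⟩
        · rw [Finset.mem_singleton] at hu
          subst hu
          exact ⟨a, Or.inl (Finset.pair_comm a u ▸ he)⟩
      · push Not at h
        exact ⟨u, Or.inr ⟨rfl, h⟩⟩
    choose f hf using hmate
    refine Finset.mem_image.mpr ⟨f, Finset.mem_univ _, ?_⟩
    ext e
    simp only [g, Finset.mem_filter, Finset.mem_image, Finset.mem_univ, true_and]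
    constructor
    · rintro ⟨⟨u, rfl⟩, hc⟩
      rcases hf u with h | ⟨h, -⟩
      · exact h
      · simp [h] at hc
    · intro he
      refine ⟨?_, hM.1 e he⟩
      obtain ⟨a, ha⟩ : e.Nonempty := Finset.card_pos.mp (by rw [hM.1 e he]; norm_num)
      refine ⟨a, ?_⟩
      rcases hf a with h | ⟨-, h⟩
      · by_contra hne
        exact Finset.disjoint_left.mp (hM.2 _ h e he hne) (by simp) ha
      · exact absurd ha (h e he)
  calc _ ≤ (Finset.univ.image g).card := Finset.card_le_card hsub
    _ ≤ Fintype.card (V → V) := Finset.card_image_le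
    _ = _ := by simp

theorem IsMatching.sqrt_two_pow_le_card_splits {M : Finset (Finset V)} (hM : IsMatching M) :
    √2 ^ Fintype.card V ≤ ((Finset.univ.filter fun X => Splits X M).card : ℝ) := by
  have h1 : ((2 : ℝ)) ^ Fintype.card V ≤
      2 ^ M.card * ((Finset.univ.filter fun X => Splits X M).card : ℝ) := by
    exact_mod_cast hM.two_pow_le_card_splits
  have h2 : (2 : ℝ) ^ M.card ≤ √2 ^ Fintype.card V := by
    rw [show (2 : ℝ) ^ M.card = √2 ^ (2 * M.card) by rw [pow_mul, Real.sq_sqrt (by norm_num)]]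
    exact pow_le_pow_right₀ (Real.one_le_sqrt.mpr (by norm_num)) hM.two_mul_card_le
  have h3 : (2 : ℝ) ^ Fintype.card V = √2 ^ Fintype.card V * √2 ^ Fintype.card V := by
    rw [← mul_pow, Real.mul_self_sqrt (by norm_num)]
  have hpos : 0 < √2 ^ Fintype.card V := by positivity
  refine le_of_mul_le_mul_left ?_ hpos
  rw [← h3]
  exact h1.trans (mul_le_mul_of_nonneg_right h2 (Nat.cast_nonneg _))

/-- By the union bound, some family of `T` sets contains, for every matching, a set
splitting it. -/
theorem exists_splitting_family (hV : 0 < Fintype.card V) {T : ℕ}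
    (hT : √2 ^ Fintype.card V * (Fintype.card V * Real.log (Fintype.card V)) < T) :
    ∃ X : Fin T → Finset V, ∀ M, IsMatching M → ∃ t, Splits (X t) M := by
  classical
  by_contra! hcon
  set d := Fintype.card V with hd
  let bad : Finset (Finset V) → Finset (Finset V) := fun M =>
    Finset.univ.filter fun X => ¬ Splits X M
  have hcover : (Finset.univ : Finset (Fin T → Finset V)) ⊆
      (Finset.univ.filter fun M : Finset (Finset V) => IsMatching M).biUnion
        fun M => Fintype.piFinset fun _ : Fin T => bad M := by
    intro X _
    obtain ⟨M, hM, hX⟩ := hcon X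
    simp only [Finset.mem_biUnion, Finset.mem_filter, Finset.mem_univ, true_and,
      Fintype.mem_piFinset, bad]
    exact ⟨M, hM, hX⟩
  have hspos : 0 < √2 ^ d := by positivity
  have hsq : (2 : ℝ) ^ d = √2 ^ d * √2 ^ d := by
    rw [← mul_pow, Real.mul_self_sqrt (by norm_num)]
  set q : ℝ := (√2 ^ d)⁻¹ with hq
  have hbad : ∀ M, IsMatching M → ((bad M).card : ℝ) ≤ 2 ^ d * Real.exp (-q) := by
    intro M hM
    have h1 := hM.sqrt_two_pow_le_card_splits
    have h2 := Finset.card_filter_add_card_filter_not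
      (s := (Finset.univ : Finset (Finset V))) (fun X => Splits X M)
    rw [Finset.card_univ, Fintype.card_finset] at h2
    have h3 : ((Finset.univ.filter fun X => Splits X M).card : ℝ) + (bad M).card = 2 ^ d := by
      exact_mod_cast h2
    have h4 : 1 - q ≤ Real.exp (-q) := by linarith [Real.add_one_le_exp (-q)]
    calc ((bad M).card : ℝ) ≤ 2 ^ d - √2 ^ d := by linarith
      _ = 2 ^ d * (1 - q) := by rw [hsq, hq]; field_simp
      _ ≤ _ := mul_le_mul_of_nonneg_left h4 (by positivity)
  have hcard : ((2 : ℝ) ^ d) ^ T ≤ (d : ℝ) ^ d * (2 ^ d * Real.exp (-q)) ^ T := by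
    have h1 := (Finset.card_le_card hcover).trans Finset.card_biUnion_le
    rw [Finset.card_univ, Fintype.card_fun, Fintype.card_finset, Fintype.card_fin] at h1
    have h2 : ((2 : ℝ) ^ d) ^ T ≤
        ∑ M ∈ Finset.univ.filter fun M : Finset (Finset V) => IsMatching M,
          ((bad M).card : ℝ) ^ T := by
      have h3 : (((2 ^ d) ^ T : ℕ) : ℝ) ≤ _ := Nat.cast_le.mpr h1
      push_cast [Fintype.card_piFinset, Finset.prod_const, Finset.card_univ,
        Fintype.card_fin] at h3
      exact h3
    refine h2.trans ?_
    refine (Finset.sum_le_card_nsmul _ _ ((2 ^ d * Real.exp (-q)) ^ T) ?_).trans ?_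
    · intro M hM
      exact pow_le_pow_left₀ (Nat.cast_nonneg _) (hbad M (Finset.mem_filter.mp hM).2) T
    · rw [nsmul_eq_mul]
      refine mul_le_mul_of_nonneg_right ?_ (by positivity)
      exact_mod_cast card_isMatching_le (V := V)
  rw [mul_pow, mul_left_comm] at hcard
  have hone : 1 ≤ (d : ℝ) ^ d * Real.exp (-q) ^ T := by
    have hp : (0 : ℝ) < (2 ^ d) ^ T := by positivity
    exact le_of_mul_le_mul_left (by simpa using hcard) hp
  have hd0 : (0 : ℝ) < d := by exact_mod_cast hV
  have hexp : (d : ℝ) ^ d * Real.exp (-q) ^ T = Real.exp (d * Real.log d - T * q) := by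
    rw [← Real.exp_nat_mul, sub_eq_add_neg, Real.exp_add, Real.exp_nat_mul (Real.log d),
      Real.exp_log hd0]
    congr 2
    ring
  rw [hexp, Real.one_le_exp_iff] at hone
  have : √2 ^ d * (d * Real.log d) < √2 ^ d * (d * Real.log d) := by
    refine hT.trans_le ?_
    calc (T : ℝ) = √2 ^ d * (T * q) := by rw [hq]; field_simp
      _ ≤ _ := mul_le_mul_of_nonneg_left (by linarith) hspos.le
  exact lt_irrefl _ this

end Counting

/-- The vertices and the edges of the complete graph on `V`. -/
abbrev Cell (V : Type*) := V ⊕ {e : Finset V // e.card = 2}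

theorem two_mul_card_cell [Fintype V] :
    2 * Fintype.card (Cell V) = Fintype.card V * (Fintype.card V + 1) := by
  have h : Fintype.card {e : Finset V // e.card = 2} = (Fintype.card V).choose 2 :=
    Fintype.card_finset_len 2
  rw [Fintype.card_sum, h, Nat.choose_two_right]
  have h2 := Nat.two_mul_div_two_of_even (Nat.even_mul_pred_self (Fintype.card V))
  rw [mul_add, h2]
  rcases Fintype.card V with _ | d
  · rfl
  · simp only [Nat.add_sub_cancel]
    ring

section Factorization

variable [DecidableEq V]

/-- The smaller of the two parts into which `X` cuts `U`. -/
def smallPart (X U : Finset V) : Finset V :=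
  if (U ∩ X).card ≤ (U \ X).card then U ∩ X else U \ X

/-- The slack of the constraint of a cell at the matching `M`. -/
def cellSlack (M : Finset (Finset V)) : Cell V → ℝ
  | .inl v => 1 - ((M.filter fun e => v ∈ e).card : ℝ)
  | .inr e => if e.1 ∈ M then 1 else 0

/-- The coefficient of a cell in the expression of the slack of `U` through a set `X`. -/
def cellCoeff (X U : Finset V) : Cell V → ℝ
  | .inl v => if v ∈ smallPart X U then 1 else 0
  | .inr e => max 0 (((e.1 ∩ smallPart X U).card : ℝ) - if e.1 ⊆ U then 1 else 0)

theorem cellCoeff_nonneg (X U : Finset V) (c : Cell V) : 0 ≤ cellCoeff X U c := by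
  rcases c with v | e
  · simp only [cellCoeff]
    split_ifs <;> norm_num
  · exact le_max_left _ _

theorem IsMatching.cellSlack_nonneg {M : Finset (Finset V)} (hM : IsMatching M) (c : Cell V) :
    0 ≤ cellSlack M c := by
  rcases c with v | e
  · have : ((M.filter fun e => v ∈ e).card : ℝ) ≤ 1 := by
      exact_mod_cast hM.card_filter_mem_le_one v
    simp only [cellSlack]
    linarith
  · simp only [cellSlack]
    split_ifs <;> norm_num

theorem two_mul_card_smallPart_add_one_le {X U : Finset V} (hU : Odd U.card) :
    2 * (smallPart X U).card + 1 ≤ U.card := by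
  obtain ⟨k, hk⟩ := hU
  have := Finset.card_inter_add_card_sdiff U X
  unfold smallPart
  split_ifs <;> omega

theorem card_inter_smallPart_of_subset {X U e : Finset V} (he : e.card = 2)
    (hX : (e ∩ X).card = 1) (hU : e ⊆ U) : (e ∩ smallPart X U).card = 1 := by
  have := Finset.card_inter_add_card_sdiff e X
  unfold smallPart
  split_ifs
  · rwa [← Finset.inter_assoc, Finset.inter_eq_left.mpr hU]
  · rw [← Finset.inter_sdiff_assoc, Finset.inter_eq_left.mpr hU]
    omega

theorem sum_edges [Fintype V] {M : Finset (Finset V)} (hM : IsMatching M) (f : Finset V → ℝ) :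
    ∑ e : {e : Finset V // e.card = 2}, f e.1 * (if e.1 ∈ M then 1 else 0) = ∑ e ∈ M, f e := by
  rw [← Finset.sum_subtype_of_mem (p := fun e => e.card = 2) f hM.1]
  simp only [mul_ite, mul_one, mul_zero]
  rw [← Finset.sum_filter]
  refine Finset.sum_congr ?_ fun _ _ => rfl
  ext e
  simp

/-- A set splitting `M` expresses the slack of an odd set as a nonnegative combination of
cell slacks. -/
theorem IsMatching.slack_eq [Fintype V] {M : Finset (Finset V)} (hM : IsMatching M) {X U : Finset V}
    (hX : Splits X M) :
    ((U.card : ℝ) - 1) / 2 - ((M.filter fun e => e ⊆ U).card : ℝ) =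
      (((U.card : ℝ) - 1) / 2 - (smallPart X U).card) +
        ∑ c, cellCoeff X U c * cellSlack M c := by
  have hvert : ∑ v : V, cellCoeff X U (.inl v) * cellSlack M (.inl v) =
      (smallPart X U).card - ∑ e ∈ M, ((e ∩ smallPart X U).card : ℝ) := by
    simp only [cellCoeff, cellSlack, ite_mul, one_mul, zero_mul]
    rw [← Finset.sum_filter, Finset.filter_mem_eq_inter, Finset.univ_inter,
      Finset.sum_sub_distrib, Finset.sum_const, nsmul_eq_mul, mul_one]
    congr 1
    have := Finset.sum_card_bipartiteAbove_eq_sum_card_bipartiteBelow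
      (s := smallPart X U) (t := M) (fun v e => v ∈ e)
    simp only [Finset.bipartiteAbove, Finset.bipartiteBelow, Finset.filter_mem_eq_inter] at this
    simp only [Finset.inter_comm _ (smallPart X U)]
    exact_mod_cast this
  have hedge : ∑ e, cellCoeff X U (.inr e) * cellSlack M (.inr e) =
      ∑ e ∈ M, ((e ∩ smallPart X U).card : ℝ) - ((M.filter fun e => e ⊆ U).card : ℝ) := by
    simp only [cellCoeff, cellSlack]
    rw [sum_edges hM fun e =>
      max 0 (((e ∩ smallPart X U).card : ℝ) - if e ⊆ U then 1 else 0)]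
    rw [Finset.card_filter, Nat.cast_sum, ← Finset.sum_sub_distrib]
    refine Finset.sum_congr rfl fun e he => ?_
    push_cast
    refine max_eq_right ?_
    split_ifs with h
    · rw [card_inter_smallPart_of_subset (hM.1 e he) (hX e he) h]
      norm_num
    · simp
  rw [Fintype.sum_sum_type, hvert, hedge]
  ring

/-- The left factor of the factorization given by a family of sets. -/
def leftFactor {T : ℕ} (X : Fin T → Finset V) :
    Finset V ⊕ (V ⊕ Finset V) → Cell V ⊕ Fin T × Option (Cell V) → ℝ
  | .inl e, .inl (.inr f) => if f.1 = e then 1 else 0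
  | .inr (.inl v), .inl (.inl w) => if w = v then 1 else 0
  | .inr (.inr U), .inr (t, none) => max 0 (((U.card : ℝ) - 1) / 2 - (smallPart (X t) U).card)
  | .inr (.inr U), .inr (t, some c) => cellCoeff (X t) U c
  | _, _ => 0

/-- The uniform distribution on the members of the family splitting `M`. -/
def weight {T : ℕ} (X : Fin T → Finset V) (M : Finset (Finset V)) (t : Fin T) : ℝ :=
  if Splits (X t) M then ((Finset.univ.filter fun t => Splits (X t) M).card : ℝ)⁻¹ else 0

/-- The right factor of the factorization given by a family of sets. -/
def rightFactor {T : ℕ} (X : Fin T → Finset V) :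
    Cell V ⊕ Fin T × Option (Cell V) → Finset (Finset V) → ℝ
  | .inl c, M => cellSlack M c
  | .inr (t, none), M => weight X M t
  | .inr (t, some c), M => weight X M t * cellSlack M c

variable {T : ℕ} {X : Fin T → Finset V}

theorem leftFactor_nonneg (i : Finset V ⊕ (V ⊕ Finset V))
    (k : Cell V ⊕ Fin T × Option (Cell V)) : 0 ≤ leftFactor X i k := by
  unfold leftFactor
  split
  · split_ifs <;> norm_num
  · split_ifs <;> norm_num
  · exact le_max_left _ _
  · exact cellCoeff_nonneg _ _ _
  · exact le_rfl

theorem weight_nonneg (M : Finset (Finset V)) (t : Fin T) : 0 ≤ weight X M t := by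
  unfold weight
  split_ifs <;> positivity

theorem sum_weight {M : Finset (Finset V)} (h : ∃ t, Splits (X t) M) :
    ∑ t, weight X M t = 1 := by
  obtain ⟨t, ht⟩ := h
  have hpos : 0 < (Finset.univ.filter fun t => Splits (X t) M).card :=
    Finset.card_pos.mpr ⟨t, by simpa using ht⟩
  simp only [weight]
  rw [← Finset.sum_filter, Finset.sum_const, nsmul_eq_mul]
  exact mul_inv_cancel₀ (by positivity)

theorem IsMatching.rightFactor_nonneg {M : Finset (Finset V)} (hM : IsMatching M)
    (k : Cell V ⊕ Fin T × Option (Cell V)) : 0 ≤ rightFactor X k M := by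
  rcases k with c | ⟨t, _ | c⟩
  · exact hM.cellSlack_nonneg c
  · exact weight_nonneg M t
  · exact mul_nonneg (weight_nonneg M t) (hM.cellSlack_nonneg c)

theorem edge_slack_eq [Fintype V] (M : Finset (Finset V)) {e : Finset V} (he : e.card = 2) :
    (if e ∈ M then (1 : ℝ) else 0) =
      ∑ k, leftFactor X (.inl e) k * rightFactor X k M := by
  rw [Fintype.sum_sum_type, Fintype.sum_sum_type,
    Fintype.sum_eq_single (⟨e, he⟩ : {e : Finset V // e.card = 2})]
  · simp [leftFactor, rightFactor, cellSlack]
  · intro f hf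
    have : f.1 ≠ e := fun h => hf (Subtype.ext h)
    simp [leftFactor, this]

theorem vertex_slack_eq [Fintype V] (M : Finset (Finset V)) (v : V) :
    (1 : ℝ) - ((M.filter fun e => v ∈ e).card : ℝ) =
      ∑ k, leftFactor X (.inr (.inl v)) k * rightFactor X k M := by
  rw [Fintype.sum_sum_type, Fintype.sum_sum_type, Fintype.sum_eq_single v]
  · simp [leftFactor, rightFactor, cellSlack]
  · intro w hw
    simp [leftFactor, hw]

theorem IsMatching.odd_slack_eq [Fintype V] {M : Finset (Finset V)} (hM : IsMatching M)
    (h : ∃ t, Splits (X t) M) {U : Finset V} (hU : Odd U.card) :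
    ((U.card : ℝ) - 1) / 2 - ((M.filter fun e => e ⊆ U).card : ℝ) =
      ∑ k, leftFactor X (.inr (.inr U)) k * rightFactor X k M := by
  set s := ((U.card : ℝ) - 1) / 2 - ((M.filter fun e => e ⊆ U).card : ℝ) with hs
  have hterm : ∀ t, ∑ o, leftFactor X (.inr (.inr U)) (.inr (t, o)) *
      rightFactor X (.inr (t, o)) M = weight X M t * s := by
    intro t
    by_cases ht : Splits (X t) M
    · have hcard : (2 * (smallPart (X t) U).card + 1 : ℝ) ≤ U.card := by
        exact_mod_cast two_mul_card_smallPart_add_one_le hU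
      rw [Fintype.sum_option, hs, hM.slack_eq ht, mul_add, Finset.mul_sum]
      simp only [leftFactor, rightFactor]
      rw [max_eq_right (by linarith), mul_comm]
      congr 1
      exact Finset.sum_congr rfl fun c _ => by ring
    · have h0 : weight X M t = 0 := if_neg ht
      rw [Fintype.sum_option]
      simp [rightFactor, h0]
  rw [Fintype.sum_sum_type, Fintype.sum_prod_type, Finset.sum_congr rfl fun t _ => hterm t,
    ← Finset.sum_mul, sum_weight h, one_mul]
  simp [leftFactor]

end Factorization

theorem rank_bound {n : ℕ} (hn : 3 ≤ n) {C T : ℝ} (hC : 2 * C = n * (n + 1))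
    (hT : T ≤ √2 ^ n * (n * Real.log n) + 1) :
    C + T * (C + 1) ≤ (n : ℝ) ^ 3 * Real.log n * 1.5 ^ n := by
  have hn' : (3 : ℝ) ≤ n := by exact_mod_cast hn
  have hlog : 1 ≤ Real.log n := by
    rw [Real.le_log_iff_exp_le (by linarith)]
    linarith [Real.exp_one_lt_three]
  set L := (n : ℝ) * Real.log n with hL
  set a := (1.5 : ℝ) ^ n with ha
  have hL3 : 3 ≤ L := by nlinarith
  have ha3 : 3.375 ≤ a := by
    calc (3.375 : ℝ) = 1.5 ^ 3 := by norm_num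
      _ ≤ a := pow_le_pow_right₀ (by norm_num) hn
  have hsqrt : √2 ^ n ≤ 0.84 * a := by
    have h1 : √2 ≤ 1.415 := Real.sqrt_le_iff.mpr ⟨by norm_num, by norm_num⟩
    obtain ⟨m, rfl⟩ := Nat.exists_eq_add_of_le hn
    calc √2 ^ (3 + m) ≤ 1.415 ^ (3 + m) := pow_le_pow_left₀ (by positivity) h1 _
      _ = 1.415 ^ 3 * 1.415 ^ m := pow_add _ _ _
      _ ≤ (0.84 * 1.5 ^ 3) * 1.5 ^ m := by gcongr <;> norm_num
      _ = 0.84 * a := by rw [ha, pow_add]; ring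
  have haL : 10 ≤ a * L := by nlinarith
  have hT' : T ≤ 0.84 * (a * L) + 1 := by nlinarith
  have hC1 : C + 1 ≤ 7 / 9 * (n : ℝ) ^ 2 := by nlinarith
  have hC0 : 0 ≤ C + 1 := by nlinarith
  calc C + T * (C + 1) ≤ (C + 1) + (0.84 * (a * L) + 1) * (C + 1) := by
        linarith [mul_le_mul_of_nonneg_right hT' hC0]
    _ = (0.84 * (a * L) + 2) * (C + 1) := by ring
    _ ≤ (0.84 * (a * L) + 2) * (7 / 9 * (n : ℝ) ^ 2) :=
        mul_le_mul_of_nonneg_left hC1 (by linarith)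
    _ ≤ (a * L) * (n : ℝ) ^ 2 := by nlinarith [sq_nonneg (n : ℝ)]
    _ = _ := by rw [hL]; ring

end EdmondsSlack


/-- The slack matrix of Edmonds' description of the matching polytope of `K_n`
(rows: edge constraints, vertex constraints, odd-set constraints; columns:
matchings) has nonnegative rank at most `n³ · ln(n) · 1.5ⁿ`. -/
theorem stmt16 (n : ℕ) (hn : 3 ≤ n) :
    ∃ r : ℕ, (r : ℝ) ≤ (n : ℝ) ^ 3 * Real.log n * 1.5 ^ n ∧
    ∃ (A : (Finset (Fin n) ⊕ (Fin n ⊕ Finset (Fin n))) → Fin r → ℝ)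
      (B : Fin r → Finset (Finset (Fin n)) → ℝ),
      (∀ i k, 0 ≤ A i k) ∧
      (∀ k M, (∀ e ∈ M, e.card = 2) →
        (∀ e ∈ M, ∀ f ∈ M, e ≠ f → Disjoint e f) → 0 ≤ B k M) ∧
      (∀ M : Finset (Finset (Fin n)),
        (∀ e ∈ M, e.card = 2) →
        (∀ e ∈ M, ∀ f ∈ M, e ≠ f → Disjoint e f) →
        ((∀ e : Finset (Fin n), e.card = 2 →
            (if e ∈ M then (1 : ℝ) else 0) = ∑ k, A (Sum.inl e) k * B k M) ∧
         (∀ v : Fin n,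
            (1 : ℝ) - ((M.filter (fun e => v ∈ e)).card : ℝ)
              = ∑ k, A (Sum.inr (Sum.inl v)) k * B k M) ∧
         (∀ U : Finset (Fin n), Odd U.card → 3 ≤ U.card →
            ((U.card : ℝ) - 1) / 2 - ((M.filter (fun e => e ⊆ U)).card : ℝ)
              = ∑ k, A (Sum.inr (Sum.inr U)) k * B k M))) := by
  have hcard : Fintype.card (Fin n) = n := Fintype.card_fin n
  have hlog : 0 ≤ √2 ^ n * (n * Real.log n) :=
    mul_nonneg (by positivity) (mul_nonneg (Nat.cast_nonneg n) (Real.log_natCast_nonneg n))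
  obtain ⟨T, hT, hT'⟩ : ∃ T : ℕ, √2 ^ n * (n * Real.log n) < T ∧
      (T : ℝ) ≤ √2 ^ n * (n * Real.log n) + 1 := by
    refine ⟨⌊√2 ^ n * (n * Real.log n)⌋₊ + 1, ?_, ?_⟩ <;> push_cast
    · exact Nat.lt_floor_add_one _
    · linarith [Nat.floor_le hlog]
  obtain ⟨X, hX⟩ := EdmondsSlack.exists_splitting_family (V := Fin n) (T := T) (by omega)
    (by rwa [hcard])
  let φ := (Fintype.equivFin
    (EdmondsSlack.Cell (Fin n) ⊕ Fin T × Option (EdmondsSlack.Cell (Fin n)))).symm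
  have hsum : ∀ f : EdmondsSlack.Cell (Fin n) ⊕ Fin T × Option (EdmondsSlack.Cell (Fin n)) → ℝ,
      ∑ k, f k = ∑ k, f (φ k) := fun f => (φ.sum_comp f).symm
  refine ⟨_, ?_, fun i k => EdmondsSlack.leftFactor X i (φ k),
    fun k M => EdmondsSlack.rightFactor X (φ k) M,
    fun i k => EdmondsSlack.leftFactor_nonneg i _,
    fun k M h₁ h₂ => EdmondsSlack.IsMatching.rightFactor_nonneg ⟨h₁, h₂⟩ _,
    fun M h₁ h₂ => ⟨fun e he => ?_, fun v => ?_, fun U hU _ => ?_⟩⟩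
  · have hC : 2 * (Fintype.card (EdmondsSlack.Cell (Fin n)) : ℝ) = n * (n + 1) := by
      have := EdmondsSlack.two_mul_card_cell (V := Fin n)
      rw [hcard] at this
      exact_mod_cast this
    rw [Fintype.card_sum, Fintype.card_prod, Fintype.card_option, Fintype.card_fin]
    simp only [Nat.cast_add, Nat.cast_mul, Nat.cast_one]
    exact EdmondsSlack.rank_bound hn hC hT'
  · exact (EdmondsSlack.edge_slack_eq M he).trans (hsum _)
  · exact (EdmondsSlack.vertex_slack_eq M v).trans (hsum _)
  · exact (EdmondsSlack.IsMatching.odd_slack_eq ⟨h₁, h₂⟩ (hX M ⟨h₁, h₂⟩) hU).trans (hsum _)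
end
end

section
/- Let n ≥ 1. The permutahedron Perm(n), defined as the convex hull in ℝⁿ of the n! vectors x_σ = (σ(1), …, σ(n)) over all permutations σ of [n], equals the set { x ∈ ℝⁿ : Σ_{i=1}^n x_i = n(n+1)/2, and Σ_{i ∈ J} x_i ≥ |J|(|J|+1)/2 for every nonempty proper subset J ⊊ [n] } (Edmonds' description). -/
noncomputable section

/-- Distinct positive integers have sum at least that of the first positive integers. -/
lemma card_mul_card_add_one_le_two_mul_sum (s : Finset ℕ) :
    s.card * (s.card + 1) ≤ 2 * ∑ k ∈ s, (k + 1) := by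
  induction s using Finset.induction_on_max with
  | empty => simp
  | insert a s hlt ih =>
    have ha : a ∉ s := fun h => lt_irrefl a (hlt a h)
    have hcard : s.card ≤ a := by
      simpa using Finset.card_le_card (fun k hk => Finset.mem_range.2 (hlt k hk))
    rw [Finset.card_insert_of_notMem ha, Finset.sum_insert ha]
    nlinarith

/-- The vertices of the permutahedron satisfy Edmonds' inequalities. -/
lemma card_le_sum_permVec {n : ℕ} (σ : Equiv.Perm (Fin n)) (J : Finset (Fin n)) :
    (J.card : ℝ) * ((J.card : ℝ) + 1) / 2 ≤ ∑ i ∈ J, permVec σ i := by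
  have h := card_mul_card_add_one_le_two_mul_sum (J.map (σ.toEmbedding.trans Fin.valEmbedding))
  rw [Finset.card_map, Finset.sum_map] at h
  have h' : (J.card : ℝ) * (J.card + 1) ≤ 2 * ∑ i ∈ J, (((σ i : ℕ) : ℝ) + 1) := by
    exact_mod_cast h
  simp only [permVec]
  linarith

lemma sum_range_cast_add_one (n : ℕ) :
    ∑ k ∈ Finset.range n, ((k : ℝ) + 1) = (n : ℝ) * ((n : ℝ) + 1) / 2 := by
  induction n with
  | zero => simp
  | succ n ih => rw [Finset.sum_range_succ, ih]; push_cast; ring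

lemma sum_permVec {n : ℕ} (σ : Equiv.Perm (Fin n)) :
    ∑ i, permVec σ i = (n : ℝ) * ((n : ℝ) + 1) / 2 := by
  simp only [permVec]
  rw [Equiv.sum_comp σ (fun i : Fin n => ((i : ℕ) : ℝ) + 1),
    Fin.sum_univ_eq_sum_range (fun k : ℕ => (k : ℝ) + 1), sum_range_cast_add_one]

/-- Abel's inequality for a monotone weight and nonnegative partial sums. -/
lemma sum_range_mul_le_of_monotone_of_sum_nonneg {d z : ℕ → ℝ} (n : ℕ)
    (hd : ∀ k < n, d k ≤ d (k + 1))
    (hz : ∀ m ≤ n, 0 ≤ ∑ k ∈ Finset.range m, z k) :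
    ∑ k ∈ Finset.range (n + 1), d k * z k ≤ d n * ∑ k ∈ Finset.range (n + 1), z k := by
  induction n with
  | zero => simp
  | succ n ih =>
    have h := ih (fun k hk => hd k (by omega)) (fun m hm => hz m (by omega))
    have hmul := mul_le_mul_of_nonneg_right (hd n (by omega)) (hz (n + 1) le_rfl)
    rw [Finset.sum_range_succ, Finset.sum_range_succ z (n + 1), mul_add]
    linarith

/-- Every linear functional is at most, at a point satisfying Edmonds' inequalities, its value
at some vertex. -/
lemma exists_sum_mul_le_sum_mul_permVec {n : ℕ} {x : Fin n → ℝ}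
    (hsum : ∑ i, x i = (n : ℝ) * ((n : ℝ) + 1) / 2)
    (hx : ∀ J : Finset (Fin n), (J.card : ℝ) * ((J.card : ℝ) + 1) / 2 ≤ ∑ i ∈ J, x i)
    (c : Fin n → ℝ) :
    ∃ σ : Equiv.Perm (Fin n), ∑ i, c i * x i ≤ ∑ i, c i * permVec σ i := by
  set τ := Tuple.sort c
  have hmono : Monotone (c ∘ τ) := Tuple.monotone_sort c
  refine ⟨τ.symm, ?_⟩
  obtain _ | n := n
  · simp
  let d : ℕ → ℝ := fun k => if h : k < n + 1 then c (τ ⟨k, h⟩) else 0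
  let z : ℕ → ℝ := fun k => if h : k < n + 1 then x (τ ⟨k, h⟩) - ((k : ℝ) + 1) else 0
  have hz : ∀ m ≤ n, 0 ≤ ∑ k ∈ Finset.range m, z k := by
    intro m hm
    have hle : m ≤ n + 1 := by omega
    have hJ := hx (Finset.univ.map ((Fin.castLEEmb hle).trans τ.toEmbedding))
    rw [Finset.card_map, Finset.sum_map, Finset.card_univ, Fintype.card_fin] at hJ
    have hzx : ∀ i : Fin m, z i = x (τ (Fin.castLE hle i)) - (((i : ℕ) : ℝ) + 1) := by
      intro i
      exact dif_pos (by omega)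
    rw [Finset.sum_range, Finset.sum_congr rfl (fun i _ => hzx i), Finset.sum_sub_distrib,
      Fin.sum_univ_eq_sum_range (fun k : ℕ => (k : ℝ) + 1), sum_range_cast_add_one]
    exact sub_nonneg.2 hJ
  have hd : ∀ k < n, d k ≤ d (k + 1) := by
    intro k hk
    simp only [d, dif_pos (show k < n + 1 by omega), dif_pos (show k + 1 < n + 1 by omega)]
    exact hmono (Fin.mk_le_mk.2 (Nat.le_succ k))
  have habel := sum_range_mul_le_of_monotone_of_sum_nonneg n hd hz
  have hdi : ∀ i : Fin (n + 1), d i = c (τ i) := fun i => dif_pos i.2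
  have hzi : ∀ i : Fin (n + 1), z i = x (τ i) - permVec τ.symm (τ i) := by
    intro i
    simp only [z, permVec, dif_pos i.2, Equiv.symm_apply_apply]
  simp only [Finset.sum_range, hdi, hzi] at habel
  rw [Equiv.sum_comp τ (fun i => c i * (x i - permVec τ.symm i)),
    Equiv.sum_comp τ (fun i => x i - permVec τ.symm i), Finset.sum_sub_distrib, hsum, sum_permVec,
    sub_self, mul_zero] at habel
  simp only [mul_sub, Finset.sum_sub_distrib] at habel
  linarith

/-- Edmonds' description of the permutahedron. -/
theorem stmt17 (n : ℕ) (hn : 1 ≤ n) :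
    convexHull ℝ {x : Fin n → ℝ | ∃ σ : Equiv.Perm (Fin n), x = permVec σ}
      = {x : Fin n → ℝ |
          (∑ i, x i) = (n : ℝ) * ((n : ℝ) + 1) / 2 ∧
          ∀ J : Finset (Fin n), J.Nonempty → J ≠ Finset.univ →
            (J.card : ℝ) * ((J.card : ℝ) + 1) / 2 ≤ ∑ i ∈ J, x i} := by
  apply Set.Subset.antisymm
  · refine convexHull_min ?_ ?_
    · rintro _ ⟨σ, rfl⟩
      exact ⟨sum_permVec σ, fun J _ _ => card_le_sum_permVec σ J⟩
    · rintro x ⟨hx, hxJ⟩ y ⟨hy, hyJ⟩ a b ha hb hab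
      obtain rfl : b = 1 - a := by linarith
      refine ⟨?_, fun J hJ hJ' => ?_⟩
      · simp only [Pi.add_apply, Pi.smul_apply, smul_eq_mul, Finset.sum_add_distrib,
          ← Finset.mul_sum, hx, hy]
        ring
      · simp only [Pi.add_apply, Pi.smul_apply, smul_eq_mul, Finset.sum_add_distrib,
          ← Finset.mul_sum]
        have h₁ := mul_le_mul_of_nonneg_left (hxJ J hJ hJ') ha
        have h₂ := mul_le_mul_of_nonneg_left (hyJ J hJ hJ') hb
        linarith
  · rintro x ⟨hsum, hxJ⟩
    have hx : ∀ J : Finset (Fin n),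
        (J.card : ℝ) * ((J.card : ℝ) + 1) / 2 ≤ ∑ i ∈ J, x i := by
      intro J
      obtain rfl | hJ := J.eq_empty_or_nonempty
      · simp
      by_cases hJ' : J = Finset.univ
      · simp [hJ', hsum]
      · exact hxJ J hJ hJ'
    by_contra hmem
    have hfin : {x : Fin n → ℝ | ∃ σ : Equiv.Perm (Fin n), x = permVec σ}.Finite :=
      (Set.finite_range (permVec (n := n))).subset (by rintro _ ⟨σ, rfl⟩; exact ⟨σ, rfl⟩)
    obtain ⟨f, u, hf, hu⟩ := geometric_hahn_banach_closed_point (convex_convexHull ℝ _)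
      (hfin.isClosed_convexHull ℝ) hmem
    have hfc : ∀ y : Fin n → ℝ, f y = ∑ i, f (Pi.single i 1) * y i := by
      intro y
      conv_lhs => rw [pi_eq_sum_univ' y, map_sum]
      refine Finset.sum_congr rfl fun i _ => ?_
      rw [map_smul, smul_eq_mul, mul_comm]
    obtain ⟨σ, hσ⟩ := exists_sum_mul_le_sum_mul_permVec hsum hx (fun i => f (Pi.single i 1))
    have hlt := hf _ (subset_convexHull ℝ _ ⟨σ, rfl⟩)
    rw [hfc] at hu hlt
    linarith
end
end

section
/- Let n ≥ 2 and let C = ((i_0, j_0), …, (i_{q−1}, j_{q−1})), with i_l < j_l, be a minimal sorting network for ℝⁿ, meaning that C is a sorting network but no proper subsequence of C is a sorting network. For a permutation σ of [n], define σ_0 := σ and x_{σ_{l+1}} := σ⁺_{i_l,j_l}(x_{σ_l}); for J ⊆ [n], define J_0 := J and χ_{J_{l+1}} := σ⁻_{i_l,j_l}(χ_{J_l}). Then for every l ∈ {0, …, q−1}: (a) there exists a permutation σ of [n] with σ_l(j_l) < σ_l(i_l); and (b) there exists a subset J ⊆ [n] with j_l ∈ J_l and i_l ∉ J_l. -/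
noncomputable section

/-- `C` is a sorting network for `ℝⁿ`: it maps every vector to its
nondecreasing rearrangement. -/
def IsSortNet {n : ℕ} (C : List (Fin n × Fin n)) : Prop :=
  ∀ x : Fin n → ℝ, Monotone (netP C x) ∧
    ∃ π : Equiv.Perm (Fin n), netP C x = x ∘ π

/-- Conditional reflections preserve the property of being ordered compatibly with another vector. -/
theorem sigP_le_of_le {n : ℕ} (i j : Fin n) {x y : Fin n → ℝ}
    (h : ∀ a b, y a ≤ y b → x a ≤ x b) (a b : Fin n) :
    sigP i j y a ≤ sigP i j y b → sigP i j x a ≤ sigP i j x b := by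
  rcases le_total (y i) (y j) with hy | hy
  all_goals
    have hx := h _ _ hy
    simp only [sigP, hy, hx, min_eq_left, min_eq_right, max_eq_left, max_eq_right]
    split_ifs <;> exact h _ _

theorem netP_le_of_le {n : ℕ} (C : List (Fin n × Fin n)) {x y : Fin n → ℝ}
    (h : ∀ a b, y a ≤ y b → x a ≤ x b) (a b : Fin n) :
    netP C y a ≤ netP C y b → netP C x a ≤ netP C x b := by
  induction C generalizing x y with
  | nil => exact h a b
  | cons p C ih => exact ih (sigP_le_of_le p.1 p.2 h)

theorem sigM_comp_of_antitone {n : ℕ} {f : ℝ → ℝ} (hf : Antitone f) (i j : Fin n)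
    (x : Fin n → ℝ) : sigM i j (f ∘ x) = f ∘ sigP i j x := by
  funext k
  simp only [sigM, sigP, Function.comp_apply]
  split_ifs
  · exact hf.map_min.symm
  · exact hf.map_max.symm
  · rfl

theorem netM_comp_of_antitone {n : ℕ} {f : ℝ → ℝ} (hf : Antitone f)
    (C : List (Fin n × Fin n)) (x : Fin n → ℝ) : netM C (f ∘ x) = f ∘ netP C x := by
  induction C generalizing x with
  | nil => rfl
  | cons p C ih =>
    have h := ih (sigP p.1 p.2 x)
    rw [← sigM_comp_of_antitone hf] at h
    exact h

theorem sigP_eq_self {n : ℕ} {i j : Fin n} {x : Fin n → ℝ} (h : x i ≤ x j) :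
    sigP i j x = x := by
  funext k
  simp only [sigP, min_eq_left h, max_eq_right h]
  split_ifs with hi hj
  · rw [hi]
  · rw [hj]
  · rfl

/-- A comparator that finds every permutation vector in order can be erased. -/
theorem netP_eraseIdx {n : ℕ} (C : List (Fin n × Fin n)) (l : Fin C.length)
    (h : ∀ σ : Equiv.Perm (Fin n), netP (C.take l.1) (permVec σ) (C.get l).1
      ≤ netP (C.take l.1) (permVec σ) (C.get l).2) (x : Fin n → ℝ) :
    netP (C.eraseIdx l.1) x = netP C x := by
  have hx : netP (C.take l.1) x (C.get l).1 ≤ netP (C.take l.1) x (C.get l).2 := by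
    refine netP_le_of_le _ (fun a b hab => ?_) _ _ (h (Tuple.sort x)⁻¹)
    have hab' : (Tuple.sort x)⁻¹ a ≤ (Tuple.sort x)⁻¹ b := by
      simpa [permVec] using hab
    simpa using Tuple.monotone_sort x hab'
  have hC : C = C.take l.1 ++ C.get l :: C.drop (l.1 + 1) := by simp
  have hfold : netP C x = netP (C.drop (l.1 + 1))
      (sigP (C.get l).1 (C.get l).2 (netP (C.take l.1) x)) := by
    conv_lhs => rw [hC]
    simp only [netP, List.foldl_append, List.foldl_cons]
  rw [hfold, sigP_eq_self hx, List.eraseIdx_eq_take_drop_succ]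
  simp only [netP, List.foldl_append]

/-- In a minimal sorting network, for every comparator `l`: (a) some
permutation arrives at `l` still out of order there (`σ_l(j_l) < σ_l(i_l)`,
where `x_{σ_l} = netP (C.take l) (permVec σ)`), and (b) some subset `J`
satisfies `j_l ∈ J_l` and `i_l ∉ J_l` (where `χ_{J_l} = netM (C.take l) (chi J)`). -/
theorem stmt19 (n : ℕ) (hn : 2 ≤ n) (C : List (Fin n × Fin n))
    (hC : ∀ p ∈ C, p.1 < p.2)
    (hsort : IsSortNet C)
    (hmin : ∀ D : List (Fin n × Fin n), D.Sublist C → D ≠ C → ¬ IsSortNet D) :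
    ∀ l : Fin C.length,
      (∃ σ : Equiv.Perm (Fin n),
        netP (C.take l.1) (permVec σ) (C.get l).2
          < netP (C.take l.1) (permVec σ) (C.get l).1) ∧
      (∃ J : Finset (Fin n),
        netM (C.take l.1) (chi J) (C.get l).2 = 1 ∧
        netM (C.take l.1) (chi J) (C.get l).1 = 0) := by
  intro l
  obtain ⟨σ, hσ⟩ : ∃ σ : Equiv.Perm (Fin n),
      netP (C.take l.1) (permVec σ) (C.get l).2
        < netP (C.take l.1) (permVec σ) (C.get l).1 := by
    by_contra! h
    refine hmin (C.eraseIdx l.1) (List.eraseIdx_sublist C l.1) (fun heq => ?_) (fun x => ?_)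
    · have hlen := congrArg List.length heq
      rw [List.length_eraseIdx_of_lt l.2] at hlen
      have := l.2
      omega
    · rw [netP_eraseIdx C l h]
      exact hsort x
  refine ⟨⟨σ, hσ⟩, ?_⟩
  let c := netP (C.take l.1) (permVec σ) (C.get l).1
  let f : ℝ → ℝ := fun t => if t < c then 1 else 0
  have hf : Antitone f := by
    intro s t hst
    by_cases ht : t < c
    · simp [f, ht, hst.trans_lt ht]
    · simp only [f, ht, if_false]
      split_ifs <;> norm_num
  have hchi : chi (Finset.univ.filter fun k => permVec σ k < c) = f ∘ permVec σ := by
    funext k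
    simp [chi, f]
  refine ⟨Finset.univ.filter fun k => permVec σ k < c, ?_, ?_⟩
  · rw [hchi, netM_comp_of_antitone hf]
    exact if_pos hσ
  · rw [hchi, netM_comp_of_antitone hf]
    exact if_neg (lt_irrefl c)
end
end
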